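/- Let n and m be integers with n ≥ 4 and 2n−3 < m ≤ C(n,2). Let G_{n,m} be a two-terminal graph in T_{n,m} with terminals s and t such that both s and t are adjacent to all other vertices (universal vertices) and the graph G_{n,m} − s − t is an H-optimal graph in the class of simple graphs on n−2 vertices with m−(2n−3) edges. Then G_{n,m} is a locally most reliable two-terminal graph in T_{n,m}, and every locally most reliable two-terminal graph in T_{n,m} is isomorphic (as a two-terminal graph) to G_{n,m}. -/

import Mathlib

noncomputable def edgeCount {V : Type} (G : SimpleGraph V) : ℕ := G.edgeSet.ncard

noncomputable def M1 {V : Type} [Fintype V] (G : SimpleGraph V) : ℕ :=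
  ∑ v : V, (G.neighborSet v).ncard ^ 2

open Classical in
/-- Second Zagreb index: each unordered edge counted once (ordered sum halved). -/
noncomputable def M2 {V : Type} [Fintype V] (G : SimpleGraph V) : ℕ :=
  (∑ u : V, ∑ v : V,
    if G.Adj u v then (G.neighborSet u).ncard * (G.neighborSet v).ncard else 0) / 2

noncomputable def k3 {V : Type} [Fintype V] (G : SimpleGraph V) : ℕ :=
  {s : Finset V | G.IsNClique 3 s}.ncard

noncomputable def Hval {V : Type} [Fintype V] (G : SimpleGraph V) : ℤ :=
  (M2 G : ℤ) - 6 * (k3 G : ℤ)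

/-- `G` is M-optimal among simple graphs on `V` with `m` edges. -/
def MOptimal {V : Type} [Fintype V] (m : ℕ) (G : SimpleGraph V) : Prop :=
  edgeCount G = m ∧ ∀ G' : SimpleGraph V, edgeCount G' = m → M1 G' ≤ M1 G

/-- `G` is H-optimal among simple graphs on `V` with `m` edges. -/
def HOptimal {V : Type} [Fintype V] (m : ℕ) (G : SimpleGraph V) : Prop :=
  MOptimal m G ∧ ∀ G' : SimpleGraph V, MOptimal m G' → Hval G' ≤ Hval G

/-- A two-terminal graph on `n` labeled vertices. -/
structure TwoTerminalGraph (n : ℕ) where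
  graph : SimpleGraph (Fin n)
  s : Fin n
  t : Fin n
  hst : s ≠ t

/-- The set of two-terminal graphs on `n` vertices with `m` edges. -/
def TT (n m : ℕ) : Set (TwoTerminalGraph n) := {G | edgeCount G.graph = m}

/-- `Ncoeff G i` = number of `i`-edge subsets `F` of `E(G)` such that the terminals
are joined by a path in the spanning subgraph `(V, F)`. -/
noncomputable def Ncoeff {n : ℕ} (G : TwoTerminalGraph n) (i : ℕ) : ℕ :=
  {F : Set (Sym2 (Fin n)) | F ⊆ G.graph.edgeSet ∧ F.ncard = i ∧
    (SimpleGraph.fromEdgeSet F).Reachable G.s G.t}.ncard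

/-- Two-terminal reliability at `p`, for a graph with `m` edges. -/
noncomputable def relia {n : ℕ} (m : ℕ) (G : TwoTerminalGraph n) (p : ℝ) : ℝ :=
  ∑ i ∈ Finset.Icc 1 m, (Ncoeff G i : ℝ) * p ^ i * (1 - p) ^ (m - i)

/-- Locally most reliable two-terminal graph in `TT n m`. -/
def IsLMRTTG (n m : ℕ) (G : TwoTerminalGraph n) : Prop :=
  G ∈ TT n m ∧ ∀ H ∈ TT n m, ∃ δ > 0, ∀ p ∈ Set.Ioo (0:ℝ) δ, relia m H p ≤ relia m G p

/-- Isomorphism of two-terminal graphs: a graph isomorphism mapping terminals to terminals. -/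
def TTIso {n : ℕ} (G H : TwoTerminalGraph n) : Prop :=
  ∃ e : G.graph ≃g H.graph, (e G.s = H.s ∧ e G.t = H.t) ∨ (e G.s = H.t ∧ e G.t = H.s)

/-- The iterated maximizing subsets `T_{n,m}^{(i)}`. -/
def TTfilter (n m : ℕ) : ℕ → Set (TwoTerminalGraph n)
  | 0 => TT n m
  | i + 1 => {G ∈ TTfilter n m i | ∀ H ∈ TTfilter n m i, Ncoeff H (i+1) ≤ Ncoeff G (i+1)}

/-- The quasi-complete graph `C¹_{n,m}` with parameters `k, j`
(`m = C(k+1,2) − j`, `1 ≤ j ≤ k`): a `K_k` on vertices `0..k-1`, one extra vertex `k`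
adjacent to exactly `k−j` vertices of the clique, and `n−k−1` isolated vertices. -/
def quasiComplete (n k j : ℕ) : SimpleGraph (Fin n) :=
  SimpleGraph.fromRel (fun a b => (a.val < k ∧ b.val < k) ∨ (a.val = k ∧ b.val < k - j))

/-- The quasi-star graph `S¹_{n,m}` with parameters `k', j'`
(`m = C(n,2) − C(k'+1,2) + j'`): the complement of the quasi-complete graph,
i.e. `K_{n−k'−1} ∨ ((K_1 ∨ j'K_1) ∪ (k'−j')K_1)`. -/
def quasiStar (n k' j' : ℕ) : SimpleGraph (Fin n) := (quasiComplete n k' j')ᶜ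

/-- `S²_{n,m} = K_{n−2k'+j'} ∨ ((K_{k'−j'} ∨ (k'−1)K_1) ∪ K_1)`. -/
def quasiStar2 (n k' j' : ℕ) : SimpleGraph (Fin n) :=
  SimpleGraph.fromRel (fun x y =>
    x.val < n - 2*k' + j' ∨
    (n - 2*k' + j' ≤ x.val ∧ x.val < n - k' ∧ n - 2*k' + j' ≤ y.val ∧ y.val < n - k') ∨
    (n - 2*k' + j' ≤ x.val ∧ x.val < n - k' ∧ n - k' ≤ y.val ∧ y.val < n - 1))

/-- `S³_{n,m} = K_{n−k'−1} ∨ (K_3 ∪ (k'−2)K_1)` (defined when `j' = 3`). -/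
def quasiStar3 (n k' : ℕ) : SimpleGraph (Fin n) :=
  SimpleGraph.fromRel (fun x y =>
    x.val < n - k' - 1 ∨
    (n - k' - 1 ≤ x.val ∧ x.val < n - k' + 2 ∧ n - k' - 1 ≤ y.val ∧ y.val < n - k' + 2))

/-- `C³_{n,m} = (K_{k−2} ∨ 3K_1) ∪ (n−k−1)K_1` (defined when `j = 3`). -/
def quasiComplete3 (n k : ℕ) : SimpleGraph (Fin n) :=
  SimpleGraph.fromRel (fun x y =>
    (x.val < k - 2 ∧ y.val < k - 2) ∨ (x.val < k - 2 ∧ k - 2 ≤ y.val ∧ y.val < k + 1))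

noncomputable def pPoly (x : ℝ) : ℝ :=
  (1/8) * ((3 - 2*Real.sqrt 2)*x^4 - (20 + 37*Real.sqrt 2)*x^3
    + (19 + 76*Real.sqrt 2)*x^2 - (46 + 226*Real.sqrt 2)*x + 72)

noncomputable def qPoly (x : ℝ) : ℝ :=
  (1/8) * (2*Real.sqrt 2*x^3 - 2*x^2 - 16*Real.sqrt 2*x + 4)

/-- The family `S^i_{n,m}` for `i ∈ {1,2,3}`. -/
def Sfam (n k' j' : ℕ) : ℕ → SimpleGraph (Fin n)
  | 1 => quasiStar n k' j'
  | 2 => quasiStar2 n k' j'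
  | 3 => quasiStar3 n k'
  | _ => ⊥

/-- Existence conditions for `S^i_{n,m}`, `i ∈ {1,2,3}`. -/
def SExists (n k' j' : ℕ) : ℕ → Prop
  | 1 => True
  | 2 => k' + 1 ≤ 2*k' - j' - 1 ∧ 2*k' - j' - 1 ≤ n - 1
  | 3 => j' = 3
  | _ => False

/-- The graph `G − s − t` obtained by deleting both terminals. -/
def deleteTerminals {n : ℕ} (G : TwoTerminalGraph n) :
    SimpleGraph {v : Fin n // v ≠ G.s ∧ v ≠ G.t} :=
  SimpleGraph.comap Subtype.val G.graph

set_option linter.unusedSimpArgs false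
set_option linter.unusedVariables false
set_option linter.unusedSectionVars false

section
namespace TL

@[ext] structure St where
  v : ℤ
  e : ℤ
  m : ℤ
  h : ℤ

def stp (b : Bool) (s : St) : St :=
  if b then ⟨s.v + 1, s.e + 2 * s.v, s.m + 2 * s.e + s.v + s.v ^ 2,
    s.h + 2 * s.m + s.e + 2 * s.v * (s.e + s.v) - 6 * s.e⟩
  else ⟨s.v + 1, s.e, s.m, s.h⟩

def ones (n : ℤ) (s : St) : St :=
  ⟨s.v + n, s.e + 2 * n * s.v + n * (n - 1),
    s.m + 2 * n * s.e + n * n * s.v + n * (s.v + n - 1) ^ 2,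
    s.h + 2 * n * s.m + n ^ 2 * s.e + 2 * n * (s.v + n - 1) * (s.e + n * s.v)
      + n * (n - 1) * (s.v + n - 1) ^ 2 - 6 * n * s.e - 6 * n * (n - 1) * s.v
      - 2 * n * (n - 1) * (n - 2)⟩

def zeros (n : ℤ) (s : St) : St := ⟨s.v + n, s.e, s.m, s.h⟩

def run (s : St) (L : List Bool) : St := L.foldr stp s

def s0 : St := ⟨0, 0, 0, 0⟩
def s1 : St := ⟨1, 0, 0, 0⟩

def st (L : List Bool) : St := run s1 L
def stF (L : List Bool) : St := run s0 L

abbrev T (n : ℕ) : List Bool := List.replicate n true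
abbrev Z (n : ℕ) : List Bool := List.replicate n false

lemma run_append (s : St) (A B : List Bool) : run s (A ++ B) = run (run s B) A := by
  simp [run, List.foldr_append]

lemma run_cons (s : St) (b : Bool) (B : List Bool) : run s (b :: B) = stp b (run s B) := rfl

lemma run_nil (s : St) : run s [] = s := rfl

lemma run_T (s : St) (n : ℕ) : run s (T n) = ones n s := by
  induction n with
  | zero => simp [run, ones]
  | succ n ih =>
    rw [T, List.replicate_succ, run_cons, ih]
    ext <;> simp [stp, ones] <;> ring

lemma run_Z (s : St) (n : ℕ) : run s (Z n) = zeros n s := by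
  induction n with
  | zero => simp [run, zeros]
  | succ n ih =>
    rw [Z, List.replicate_succ, run_cons, ih]
    ext <;> simp [stp, zeros]; ring

lemma run_v (s : St) (L : List Bool) : (run s L).v = s.v + L.length := by
  induction L with
  | nil => simp [run_nil]
  | cons b L ih => rw [run_cons]; cases b <;> simp [stp, ih] <;> ring

lemma stF_snoc (M : List Bool) (b : Bool) : stF (M ++ [b]) = st M := by
  rw [stF, run_append, st]; congr 1
  cases b <;> simp [run, stp, s0, s1]

def Opt (L : List Bool) : Prop :=
  ∀ L' : List Bool, L'.length = L.length → (st L').e = (st L).e → (st L').m ≤ (st L).m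

/-- full-list comparison -/
lemma Opt.full {L F : List Bool} (h : Opt L) (hl : F.length = L.length + 1)
    (he : (stF F).e = (st L).e) : (stF F).m ≤ (st L).m := by
  rcases List.eq_nil_or_concat F with rfl | ⟨M, b, rfl⟩
  · simp at hl
  · rw [List.concat_eq_append, stF_snoc] at *
    exact h M (by simpa using hl) he

lemma Opt.of_full {M G F : List Bool} (h : Opt M) (hG : stF G = st M)
   (hl : F.length = G.length)
    (he : (stF F).e = (stF G).e) : (stF F).m ≤ (stF G).m := by
  rw [hG] at he ⊢
  refine h.full ?_ he
  have h1 := congrArg St.v hG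
  rw [stF, st, run_v, run_v] at h1
  simp [s0, s1] at h1
  omega

lemma Opt.tail {b : Bool} {L : List Bool} (h : Opt (b :: L)) : Opt L := by
  intro L' hl he
  have hv : (st L').v = (st L).v := by rw [st, st, run_v, run_v, hl]
  have := h (b :: L') (by simp [hl])
  unfold st at *
  rw [run_cons, run_cons] at this
  cases b <;> simp [stp, he, hv] at this <;> linarith

lemma Opt.of_eq {L L' : List Bool} (h : Opt L) (hl : L'.length = L.length)
    (he : (st L').e = (st L).e) (hm : (st L').m = (st L).m) : Opt L' := by
  intro M h1 h2
  rw [hm]; exact h M (by omega) (by rw [h2, he])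

/-- complement -/
def cpl (L : List Bool) : List Bool := L.map not

lemma cpl_cpl (L : List Bool) : cpl (cpl L) = L := by
  induction L with
  | nil => rfl
  | cons b L ih => simp only [cpl, List.map_cons] at *; rw [ih, Bool.not_not]

lemma cpl_length (L : List Bool) : (cpl L).length = L.length := by simp [cpl]

lemma cpl_e (L : List Bool) : (st (cpl L)).e = (L.length + 1) * L.length - (st L).e := by
  induction L with
  | nil => simp [cpl, st, run_nil, s1]
  | cons b L ih =>
    have h1 := run_v s1 L
    have h2 := run_v s1 (cpl L)
    rw [cpl_length] at h2
    have hs : s1.v = 1 := rfl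
    simp only [cpl, List.map_cons, st, run_cons, hs] at *
    cases b <;> simp [stp, ih, h1, h2] <;> ring

lemma cpl_m (L : List Bool) : (st (cpl L)).m =
    (L.length + 1) * L.length ^ 2 - 2 * L.length * (st L).e + (st L).m := by
  induction L with
  | nil => simp [cpl, st, run_nil, s1]
  | cons b L ih =>
    have h1 := run_v s1 L
    have h2 := run_v s1 (cpl L)
    have h3 := cpl_e L
    rw [cpl_length] at h2
    have hs : s1.v = 1 := rfl
    simp only [cpl, List.map_cons, st, run_cons, hs] at *
    cases b <;> simp [stp, ih, h1, h2, h3] <;> ring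

lemma Opt.cpl {L : List Bool} (h : Opt L) : Opt (cpl L) := by
  intro M hl he
  rw [cpl_length] at hl
  have := h (TL.cpl M) (by rw [cpl_length, hl]) (by rw [cpl_e, he, cpl_e, hl]; ring)
  rw [cpl_m, he, cpl_e, hl] at this
  rw [cpl_m]
  nlinarith

end TL
end

section
namespace TL

lemma nonopt {M F : List Bool} (hl : F.length = M.length + 1) (he : (stF F).e = (st M).e)
    (hm : (st M).m < (stF F).m) : ¬ Opt M := fun h => by
  have := h.full hl he
  omega

lemma run_T' (s : St) (n : ℕ) : run s (List.replicate n true) = ones n s := run_T s n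
lemma run_Z' (s : St) (n : ℕ) : run s (List.replicate n false) = zeros n s := run_Z s n
lemma stp_t (s : St) : stp true s = ⟨s.v + 1, s.e + 2 * s.v, s.m + 2 * s.e + s.v + s.v ^ 2,
    s.h + 2 * s.m + s.e + 2 * s.v * (s.e + s.v) - 6 * s.e⟩ := rfl
lemma stp_f (s : St) : stp false s = ⟨s.v + 1, s.e, s.m, s.h⟩ := rfl

lemma N1a (j k : ℕ) : ¬ Opt (false :: (T (k+3+j) ++ Z (k+3))) := by
  apply nonopt (F := false :: (T j ++ false :: (T (k+4) ++ (Z k ++ [true, false]))))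
  · simp; omega
  · simp only [stF, st, run_append, run_cons, run_nil, run_T', run_Z', ones, zeros, stp_t, stp_f, s0, s1]
    push_cast; ring
  · rw [← sub_pos]
    simp only [stF, st, run_append, run_cons, run_nil, run_T', run_Z', ones, zeros, stp_t, stp_f, s0, s1]
    push_cast; ring_nf; norm_num

lemma N1 (b c : ℕ) (hc : 3 ≤ c) (hb : c ≤ b) : ¬ Opt (false :: (T b ++ Z c)) := by
  obtain ⟨k, rfl⟩ := Nat.exists_eq_add_of_le' hc
  obtain ⟨j, rfl⟩ := Nat.exists_eq_add_of_le hb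
  exact N1a j k

lemma N2a (B k : ℕ) : ¬ Opt (false :: false :: (T (B+2) ++ Z (B+1+k))) := by
  apply nonopt (F := true :: false :: (T B ++ (Z (B+3) ++ true :: Z k)))
  · simp; omega
  · simp only [stF, st, run_append, run_cons, run_nil, run_T', run_Z', ones, zeros, stp_t, stp_f, s0, s1]
    push_cast; ring
  · rw [← sub_pos]
    simp only [stF, st, run_append, run_cons, run_nil, run_T', run_Z', ones, zeros, stp_t, stp_f, s0, s1]
    push_cast; ring_nf; norm_num

lemma N2 (b c : ℕ) (hb : 2 ≤ b) (hc : b + 1 ≤ c) : ¬ Opt (false :: false :: (T b ++ Z c)) := by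
  obtain ⟨B, rfl⟩ := Nat.exists_eq_add_of_le' hb
  obtain ⟨k, rfl⟩ := Nat.exists_eq_add_of_le hc
  have := N2a B (k+2)
  rwa [show B + 1 + (k+2) = B+2+1+k by ring] at this

lemma T1i (A R k : ℕ) : ¬ Opt (false :: (T (A+1) ++ (Z (R+1) ++ true :: Z (A+k)))) := by
  apply nonopt (F := T (A+1) ++ (Z (R+A+3) ++ true :: Z k))
  · simp; omega
  · simp only [stF, st, run_append, run_cons, run_nil, run_T', run_Z', ones, zeros, stp_t, stp_f, s0, s1]
    push_cast; ring
  · rw [← sub_pos]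
    simp only [stF, st, run_append, run_cons, run_nil, run_T', run_Z', ones, zeros, stp_t, stp_f, s0, s1]
    push_cast; ring_nf; positivity

lemma T1ii (c j k : ℕ) : ¬ Opt (false :: (T (c+2+j) ++ (Z (j+k+2) ++ true :: Z c))) := by
  apply nonopt (F := T (c+1) ++ false :: (T (j+1) ++ Z (j+k+c+4)))
  · simp; omega
  · simp only [stF, st, run_append, run_cons, run_nil, run_T', run_Z', ones, zeros, stp_t, stp_f, s0, s1]
    push_cast; ring
  · rw [← sub_pos]
    simp only [stF, st, run_append, run_cons, run_nil, run_T', run_Z', ones, zeros, stp_t, stp_f, s0, s1]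
    push_cast; ring_nf; positivity

lemma T1iii (c R k : ℕ) : ¬ Opt (false :: (T (R+c+3+k) ++ (Z (R+2) ++ true :: Z c))) := by
  apply nonopt (F := false :: (T (k+1) ++ false :: (T (R+c+3) ++ (Z R ++ true :: Z (c+1)))))
  · simp; omega
  · simp only [stF, st, run_append, run_cons, run_nil, run_T', run_Z', ones, zeros, stp_t, stp_f, s0, s1]
    push_cast; ring
  · rw [← sub_pos]
    simp only [stF, st, run_append, run_cons, run_nil, run_T', run_Z', ones, zeros, stp_t, stp_f, s0, s1]
    push_cast; ring_nf; positivity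

lemma T1iv (D k : ℕ) : ¬ Opt (false :: (T (D+3+k) ++ (Z 1 ++ true :: Z (D+1)))) := by
  apply nonopt (F := false :: (T (k+2) ++ false :: (T (D+2) ++ true :: Z (D+1))))
  · simp; omega
  · simp only [stF, st, run_append, run_cons, run_nil, run_T', run_Z', ones, zeros, stp_t, stp_f, s0, s1]
    push_cast; ring
  · rw [← sub_pos]
    simp only [stF, st, run_append, run_cons, run_nil, run_T', run_Z', ones, zeros, stp_t, stp_f, s0, s1]
    push_cast; ring_nf; positivity

lemma T1 (a r c : ℕ) (ha : 1 ≤ a) (hr : 1 ≤ r) (h : 2 ≤ r ∨ 1 ≤ c) :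
    ¬ Opt (false :: (T a ++ (Z r ++ true :: Z c))) := by
  rcases le_or_gt a (c+1) with h1 | h1
  · obtain ⟨k, hk⟩ := Nat.exists_eq_add_of_le h1
    have := T1i (a-1) (r-1) k
    rwa [show a-1+1 = a by omega, show r-1+1=r by omega, show a-1+k=c by omega] at this
  · rcases lt_or_ge a (r+(c+1)) with h2 | h2
    · have := T1ii c (a-c-2) (r+c-a)
      rwa [show c+2+(a-c-2) = a by omega, show a-c-2+(r+c-a)+2=r by omega] at this
    · rcases le_or_gt 2 r with h3 | h3
      · have := T1iii c (r-2) (a-r-c-1)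
        rwa [show (r-2)+c+3+(a-r-c-1) = a by omega, show r-2+2=r by omega] at this
      · have := T1iv (c-1) (a-2-c)
        rwa [show c-1+3+(a-2-c)=a by omega, show c-1+1=c by omega, show 1 = r by omega] at this

lemma T2 (a b c : ℕ) (ha : 1 ≤ a) (hb : 2 ≤ b) (hc : b + 1 ≤ c) :
    ¬ Opt (false :: (T a ++ false :: (T b ++ Z c))) := by
  obtain ⟨B, rfl⟩ := Nat.exists_eq_add_of_le' hb
  obtain ⟨k, rfl⟩ := Nat.exists_eq_add_of_le hc
  intro h
  refine T1 (a+B+1) (B+2) (k+2) (by omega) (by omega) (by omega) (h.of_eq ?_ ?_ ?_)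
  · simp; omega
  · simp only [stF, st, run_append, run_cons, run_nil, run_T', run_Z', ones, zeros, stp_t, stp_f, s0, s1]
    push_cast; ring
  · simp only [stF, st, run_append, run_cons, run_nil, run_T', run_Z', ones, zeros, stp_t, stp_f, s0, s1]
    push_cast; ring

lemma T3 (a r : ℕ) (ha : 1 ≤ a) (hr : 2 ≤ r) :
    ¬ Opt (false :: (T a ++ (Z r ++ [true, true]))) := by
  obtain ⟨k, rfl⟩ := Nat.exists_eq_add_of_le' hr
  intro h
  refine T1 a (k+1) 2 (by omega) (by omega) (by omega) (h.of_eq ?_ ?_ ?_)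
  · simp
  · simp only [stF, st, run_append, run_cons, run_nil, run_T', run_Z', ones, zeros, stp_t, stp_f, s0, s1]
    push_cast; ring
  · simp only [stF, st, run_append, run_cons, run_nil, run_T', run_Z', ones, zeros, stp_t, stp_f, s0, s1]
    push_cast; ring
end TL
end

section
namespace TL

def SCls (L : List Bool) : Prop :=
  (∃ a r, L = T a ++ Z r) ∨ (∃ a r c, 1 ≤ r ∧ L = T a ++ (Z r ++ true :: Z c)) ∨
  (∃ a b c, 2 ≤ b ∧ b + 1 ≤ c ∧ L = T a ++ false :: (T b ++ Z c)) ∨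
  (∃ a r, 2 ≤ r ∧ L = T a ++ (Z r ++ [true, true]))

lemma cpl_app (A B : List Bool) : cpl (A ++ B) = cpl A ++ cpl B := by simp [cpl]
lemma cpl_T (n : ℕ) : cpl (T n) = Z n := by simp [cpl]
lemma cpl_Z (n : ℕ) : cpl (Z n) = T n := by simp [cpl]
lemma cpl_T' (n : ℕ) : cpl (List.replicate n true) = Z n := by simp [cpl]
lemma cpl_Z' (n : ℕ) : cpl (List.replicate n false) = T n := by simp [cpl]
lemma cpl_cons (b : Bool) (B : List Bool) : cpl (b :: B) = (!b) :: cpl B := by simp [cpl]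
lemma cpl_nil : cpl [] = [] := rfl

lemma SCls.cons {L : List Bool} (h : SCls L) : SCls (true :: L) := by
  rcases h with ⟨a, r, rfl⟩ | ⟨a, r, c, h, rfl⟩ | ⟨a, b, c, h1, h3, rfl⟩ | ⟨a, r, h, rfl⟩
  · exact Or.inl ⟨a+1, r, by simp [List.replicate_succ]⟩
  · exact Or.inr (Or.inl ⟨a+1, r, c, h, by simp [List.replicate_succ]⟩)
  · exact Or.inr (Or.inr (Or.inl ⟨a+1, b, c, h1, h3, by simp [List.replicate_succ]⟩))
  · exact Or.inr (Or.inr (Or.inr ⟨a+1, r, h, by simp [List.replicate_succ]⟩))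

lemma SCls.step {L : List Bool} (h : SCls L) (ho : Opt (false :: L)) :
    SCls (false :: L) ∨ SCls (cpl (false :: L)) := by
  rcases h with ⟨a, r, rfl⟩ | ⟨a, r, c, h, rfl⟩ | ⟨a, b, c, h1, h3, rfl⟩ | ⟨a, r, h, rfl⟩
  · rcases Nat.eq_zero_or_pos a with rfl | ha
    · exact Or.inl (Or.inl ⟨0, r+1, by simp [List.replicate_succ]⟩)
    · rcases Nat.lt_or_ge r 3 with hr | hr
      · interval_cases r
        · exact Or.inr (Or.inl ⟨1, a, by simp [cpl]⟩)
        · exact Or.inr (Or.inr (Or.inl ⟨1, a, 0, ha, by simp [cpl]⟩))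
        · rcases Nat.lt_or_ge a 2 with h2 | h2
          · obtain rfl : a = 1 := by omega
            exact Or.inl (Or.inr (Or.inl ⟨0, 1, 2, le_rfl, by simp⟩))
          · exact Or.inr (Or.inr (Or.inr (Or.inr ⟨1, a, h2, by simp [cpl]⟩)))
      · rcases Nat.lt_or_ge a 2 with h2 | h2
        · obtain rfl : a = 1 := by omega
          exact Or.inl (Or.inr (Or.inl ⟨0, 1, r, le_rfl, by simp⟩))
        · rcases Nat.lt_or_ge a r with h3 | h3
          · exact Or.inl (Or.inr (Or.inr (Or.inl ⟨0, a, r, h2, h3, by simp⟩)))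
          · exact absurd ho (N1 a r hr h3)
  · rcases Nat.eq_zero_or_pos a with rfl | ha
    · exact Or.inl (Or.inr (Or.inl ⟨0, r+1, c, by omega, by simp [List.replicate_succ]⟩))
    · by_cases hh : 2 ≤ r ∨ 1 ≤ c
      · exact absurd ho (T1 a r c ha h hh)
      · obtain rfl : r = 1 := by omega
        obtain rfl : c = 0 := by omega
        exact Or.inr (Or.inr (Or.inl ⟨1, a, 1, ha, by simp [cpl]⟩))
  · rcases Nat.eq_zero_or_pos a with rfl | ha
    · exact absurd ho (by simpa using N2 b c h1 h3)
    · exact absurd ho (T2 a b c ha h1 h3)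
  · rcases Nat.eq_zero_or_pos a with rfl | ha
    · exact Or.inr (Or.inl ⟨r+1, 2, by simp [cpl, List.replicate_succ]⟩)
    · exact absurd ho (T3 a r ha h)

theorem cls (L : List Bool) (h : Opt L) : SCls L ∨ SCls (cpl L) := by
  induction L with
  | nil => exact Or.inl (Or.inl ⟨0, 0, rfl⟩)
  | cons b L ih =>
    have ih := ih h.tail
    cases b with
    | false =>
      rcases ih with ih | ih
      · exact ih.step h
      · exact Or.inr (by simpa [cpl_cons] using ih.cons)
    | true =>
      rcases ih with ih | ih
      · exact Or.inl ih.cons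
      · have h2 := h.cpl
        rw [cpl_cons] at h2
        have := ih.step h2
        rw [cpl_cons, cpl_cpl] at this
        rw [cpl_cons]
        exact this.symm
end TL
end

section
namespace TL

def DD (a i u c d : ℤ) : ℤ := 2*a^2*i*u + a^2*i^2 + 2*a^3*i + 2*d^2*u - 4*a*i*u + a*i^2
  - 4*a*d*u - 4*a*d*i + 2*a*d^2 + 4*a*c*u + 4*a*c*i - 2*a*c^2 - 6*a^2*i - 4*a^2*d + 4*d*u
  - 3*d^2 - 6*c*u - 4*c*d + 2*c^2 - 2*a*i + 12*a*d - 2*a*c + d + 4*c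

def gn (b c : ℤ) : ℤ := 2*b^3 + 2*c*b^2 - 9*b^2 - 2*c*b + 7*b

def chk (a i u c : ℤ) : Bool :=
  let d := a*i + c - (u^2+u)/2
  !(decide (1 ≤ a) && decide (2 ≤ i) && decide (0 ≤ d) && decide (d ≤ a + u) && decide (8 ≤ a+u+i+1) &&
    decide (a*i*(a-i) = d*(2*a-d-1) - c*(2*u-c-1))) ||
  (decide (0 < DD a i u c d) && (decide (u+i-c ≤ 1) || decide (a < u+i-c) ||
    decide (gn (u+i-c) c < DD a i u c d)))

def chkAll : Bool :=
  (List.range 15).all fun a => (List.range 8).all fun i => (List.range 9).all fun u =>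
    (List.range (u+i)).all fun c => chk a i u c

lemma chkAll_true : chkAll = true := by decide +kernel

lemma fin_case (a i u c d : ℤ) (ha : 1 ≤ a) (hi : 2 ≤ i) (hu : 0 ≤ u) (hc : 0 ≤ c)
    (hc2 : c ≤ u + i - 1) (hd : 0 ≤ d) (hd2 : d ≤ a + u)
    (E : u^2 + u + 2*d = 2*a*i + 2*c) (hT : a*i*(a-i) = d*(2*a-d-1) - c*(2*u-c-1))
    (hv : 8 ≤ a+u+i+1) (ha' : a ≤ 14) (hi' : i ≤ 7) (hu' : u ≤ 8) :
    0 < DD a i u c d ∧ (2 ≤ u+i-c → u+i-c ≤ a → gn (u+i-c) c < DD a i u c d) := by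
  have h := chkAll_true
  obtain ⟨a, rfl⟩ := Int.eq_ofNat_of_zero_le (show 0 ≤ a by omega)
  obtain ⟨i, rfl⟩ := Int.eq_ofNat_of_zero_le (show 0 ≤ i by omega)
  obtain ⟨u, rfl⟩ := Int.eq_ofNat_of_zero_le (show 0 ≤ u by omega)
  obtain ⟨c, rfl⟩ := Int.eq_ofNat_of_zero_le (show 0 ≤ c by omega)
  simp only [chkAll, List.all_eq_true, List.mem_range] at h
  have h := h a (by omega) i (by omega) u (by omega) c (by omega)
  have hd3 : (a:ℤ)*i + c - ((u:ℤ)^2+u)/2 = d := by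
    have : ((u:ℤ)^2+u) = 2*(a*i+c-d) := by linarith
    rw [this]; omega
  simp only [chk, hd3] at h
  simp only [Bool.or_eq_true, Bool.not_eq_true', Bool.and_eq_true, decide_eq_true_eq, ← Bool.not_eq_true] at h
  rcases h with h | ⟨h1, h2⟩
  · exact absurd ⟨⟨⟨⟨⟨ha, hi⟩, hd⟩, hd2⟩, hv⟩, hT⟩ h
  · refine ⟨h1, fun h3 h4 => ?_⟩
    rcases h2 with (h2 | h2) | h2
    · omega
    · omega
    · exact h2

lemma key_aux (A y x : ℤ) (hA : 0 ≤ A) (hy : 0 ≤ y) (hx : 0 ≤ x) (hx4 : x ≤ 4) :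
    (4*(A+5)*((A+4+x)+(A+5)+(A+6+y)) - 12*(A+5) - 4*(A+6+y) - 1)^2 <
    4*(2*(A+5)+2*(A+6+y)-3)*(2*(A+5)^2*(A+4+x)*(A+6+y) + (A+5)^2*(A+4+x)^2 + 2*(A+5)^3*(A+4+x)
     - 4*(A+5)*(A+4+x)*(A+6+y) + (A+5)*(A+4+x)^2 - 6*(A+5)^2*(A+4+x) - 2*(A+5)*(A+4+x)
     - 2*(A+5)^2*((A+6+y)+(A+4+x))) := by
  rw [← sub_pos]
  have h : x = 0 ∨ x = 1 ∨ x = 2 ∨ x = 3 ∨ x = 4 := by omega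
  obtain ⟨A, rfl⟩ := Int.eq_ofNat_of_zero_le hA
  obtain ⟨y, rfl⟩ := Int.eq_ofNat_of_zero_le hy
  clear hA hy hx hx4
  rcases h with rfl | rfl | rfl | rfl | rfl <;> ring_nf <;> positivity

lemma big_aux (a i u c d : ℤ) (ha : 5 ≤ a) (hu : a + 1 ≤ u) (hi1 : a - 1 ≤ i) (hi2 : i ≤ a + 3)
    (hc : 0 ≤ c) (hc2 : c ≤ u + i - 1) (hd : 0 ≤ d) (hd2 : d ≤ a + u) :
    2*a^2*(u+i) < DD a i u c d := by
  have hcp : 0 ≤ c * (4*a*(u+i) - 2*a*c - 6*u - 4*d + 2*c - 2*a + 4) := by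
    apply mul_nonneg hc
    nlinarith [mul_nonneg (show 0 ≤ a - 5 by omega) (show 0 ≤ u + i - 1 - c by omega),
      mul_nonneg (show 0 ≤ a - 5 by omega) (show 0 ≤ u by omega),
      mul_nonneg (show 0 ≤ a - 5 by omega) (show 0 ≤ i by omega)]
  have hq : 0 < 2*a + 2*u - 3 := by omega
  set q := 2*a+2*u-3 with hqd
  set p := 4*a*(i+a+u) - 12*a - 4*u - 1 with hpd
  set R := 2*a^2*i*u + a^2*i^2 + 2*a^3*i - 4*a*i*u + a*i^2 - 6*a^2*i - 2*a*i - 2*a^2*(u+i) with hR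
  have hDD : DD a i u c d - 2*a^2*(u+i) = R + (q*d^2 - p*d) +
      c * (4*a*(u+i) - 2*a*c - 6*u - 4*d + 2*c - 2*a + 4) := by
    simp only [DD, hqd, hpd, hR]; ring
  have key : p^2 < 4*q*R := by
    have := key_aux (a-5) (u-a-1) (i-a+1) (by omega) (by omega) (by omega) (by omega)
    simp only [hqd, hpd, hR]
    convert this using 1 <;> ring
  have h1 : 0 < 4*q*(R + (q*d^2 - p*d)) := by nlinarith [sq_nonneg (2*q*d - p)]
  have h2 : 0 < R + (q*d^2 - p*d) := by
    by_contra hh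
    push Not at hh
    nlinarith
  linarith

lemma main_ineq (a i u c d : ℤ) (ha : 1 ≤ a) (hi : 2 ≤ i) (hu : 0 ≤ u) (hc : 0 ≤ c)
    (hc2 : c ≤ u + i - 1) (hd : 0 ≤ d) (hd2 : d ≤ a + u)
    (E : u^2 + u + 2*d = 2*a*i + 2*c) (hT : a*i*(a-i) = d*(2*a-d-1) - c*(2*u-c-1))
    (hv : 8 ≤ a+u+i+1) :
    0 < DD a i u c d ∧ (2 ≤ u+i-c → u+i-c ≤ a → gn (u+i-c) c < DD a i u c d) := by
  have sqd : ∀ x : ℤ, 0 ≤ x * (x + 1) := fun x => by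
    rcases le_or_gt 0 x with h | h
    · positivity
    · nlinarith
  have P1 : i ≤ u → a - 1 ≤ i := by
    intro h
    by_contra hh
    push Not at hh
    have h1 : 0 ≤ c * (2*u-c-1) := mul_nonneg hc (by omega)
    have h2 := sqd (d - a)
    have h3 : 0 < a * ((i-1)*(a-i-1)) := by
      apply mul_pos (by omega) (mul_pos (by omega) (by omega))
    nlinarith
  rcases le_or_gt (a+1) u with hau | hau
  · have P2 : i ≤ a + 3 := by
      by_contra hh
      push Not at hh
      have hC : (i-1)*(a+1)*(i-2-a) = (u+i-c)*(2*(i-1)-(u+i-c)-1)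
          - (a+u+1-d)*(2*u-(a+u+1-d)-1) := by linear_combination 2*E - hT
      have h2 := sqd (u+i-c - (i-1))
      have h3 : a+2 ≤ (i-1)*(a*(i-a-3)) - 1 := by nlinarith [mul_pos (show 0 < a by omega) (show 0 < i - a - 3 by omega)]
      by_cases hk : a+u+1-d ≤ 2*u-1
      · have h1 : 0 ≤ (a+u+1-d)*(2*u-(a+u+1-d)-1) := mul_nonneg (by omega) (by omega)
        nlinarith
      · have hd0 : d = 0 := by omega
        have hu0 : u = a + 1 := by omega
        subst hd0 hu0
        rcases le_or_gt a 1 with h5 | h5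
        · have : a = 1 := by omega
          subst this
          omega
        · have h4 : 2*(a+1) + 1 ≤ (i-1)*(a*(i-a-3)) := by
            have : a ≤ a*(i-a-3) := by nlinarith
            nlinarith
          nlinarith
    rcases le_or_gt a 4 with h4 | h4
    · apply fin_case <;> try assumption
      · omega
      · omega
      · have : u*(u-1) ≤ 68 := by nlinarith
        nlinarith
    · have hi1 : a - 1 ≤ i := by
        rcases le_or_gt i u with h | h
        · exact P1 h
        · omega
      have hb := big_aux a i u c d (by omega) hau hi1 P2 hc hc2 hd hd2
      refine ⟨lt_of_le_of_lt (by positivity) hb, fun h5 h6 => lt_of_le_of_lt ?_ hb⟩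
      have h7 : gn (u+i-c) c ≤ 2*(u+i-c)^2*(u+i) := by
        simp only [gn]
        generalize hb' : u + i - c = b at *
        have : u + i = b + c := by omega
        rw [this]
        nlinarith [mul_nonneg hc (show 0 ≤ b by omega)]
      refine h7.trans ?_
      have : (u+i-c)^2 ≤ a^2 := by nlinarith
      nlinarith
  · -- u ≤ a
    have h1 : 2*i ≤ u + 5 := by
      by_contra hh
      push Not at hh
      nlinarith
    apply fin_case <;> try assumption
    · rcases le_or_gt u 4 with h | h
      · nlinarith
      · have := P1 (by omega)
        omega
    · rcases le_or_gt u 4 with h | h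
      · omega
      · have := P1 (by omega)
        omega
    · rcases le_or_gt u 4 with h | h
      · omega
      · have := P1 (by omega)
        omega
end TL
end

section
namespace TL

def HOptL (L : List Bool) : Prop := Opt L ∧ ∀ L' : List Bool, L'.length = L.length →
  (st L').e = (st L).e → (st L').m = (st L).m → (st L').h ≤ (st L).h

lemma HOptL.tail {b : Bool} {L : List Bool} (h : HOptL (b :: L)) : HOptL L := by
  refine ⟨h.1.tail, fun L' hl he hm => ?_⟩
  have hv : (st L').v = (st L).v := by rw [st, st, run_v, run_v, hl]
  have := h.2 (b :: L') (by simp [hl])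
  unfold st at *
  rw [run_cons, run_cons] at this
  cases b <;> simp [stp, he, hv, hm] at this <;> linarith

lemma not_HOptL {L : List Bool} (L' : List Bool) (hl : L'.length = L.length)
  (he : (st L').e = (st L).e) (hm : (st L').m = (st L).m) (hh : (st L).h < (st L').h) : ¬ HOptL L :=
  fun h => by have := h.2 L' hl he hm; omega

def Sst (a r c : ℤ) : St := ones a (zeros r (stp true (zeros c s0)))
def Cst (i d j : ℤ) : St := zeros i (ones d (stp false (ones j s0)))

lemma tie (a r c i d j : ℤ) (ha : 1 ≤ a) (hr : 1 ≤ r) (hc : 0 ≤ c) (hi : 0 ≤ i) (hd : 0 ≤ d)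
    (hj : 1 ≤ j) (hid : 1 ≤ i ∨ d = 0) (hv : (Sst a r c).v = (Cst i d j).v) (hv8 : 8 ≤ (Sst a r c).v)
    (he : (Sst a r c).e = (Cst i d j).e) (hm : (Sst a r c).m = (Cst i d j).m) :
    (Sst a r c).h < (Cst i d j).h ∧ (2 ≤ r → r ≤ a → (Sst a r c).h + gn r c < (Cst i d j).h) := by
  obtain ⟨u, rfl⟩ : ∃ u, j = u + 1 + a - d := ⟨j - 1 - a + d, by ring⟩
  obtain ⟨I, rfl⟩ : ∃ I, i = I - 1 := ⟨i+1, by ring⟩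
  simp only [Sst, Cst, ones, zeros, stp_t, stp_f, s0] at hv hv8 he hm ⊢
  obtain rfl : r = u + I - c := by linarith
  have E : u^2 + u + 2*d = 2*a*I + 2*c := by linear_combination -he
  have hT : a*I*(a-I) = d*(2*a-d-1) - c*(2*u-c-1) := by linear_combination -hm - (u+2*a)*E
  have hu : 0 ≤ u := by
    by_contra hh
    push Not at hh
    nlinarith
  have hI : 2 ≤ I := by
    rcases hid with h | rfl
    · omega
    · by_contra hh
      obtain rfl : I = 1 := by omega
      have h1 : c ≤ u := by linarith
      rcases eq_or_lt_of_le hu with h0 | h0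
      · subst h0; nlinarith
      · have h2 : 0 ≤ c*(2*u-c-1) := mul_nonneg hc (by omega)
        have h3 : a = 1 := by nlinarith
        subst h3
        have h4 : c*(2*u-c-1) = 0 := by linarith
        rcases mul_eq_zero.1 h4 with h5 | h5
        · subst h5; nlinarith
        · nlinarith
  have := main_ineq a I u c d ha hI hu hc (by linarith) hd (by linarith) E hT (by linarith)
  have key : DD a I u c d = (zeros (I-1) (ones d (stp false (ones (u+1+a-d) s0)))).h -
     (ones a (zeros (u+I-c) (stp true (zeros c s0)))).h := by
    simp only [Sst, Cst, ones, zeros, stp_t, stp_f, s0, DD]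
    linear_combination (-(u^2 +4*a*u +2*a*I +3*a^2 -2*u +2*c -6*a +2)) * E
  simp only [ones, zeros, stp_t, stp_f, s0] at key
  rw [key] at this
  refine ⟨by linarith [this.1], fun h1 h2 => by linarith [this.2 h1 h2]⟩

lemma Sst_inj (a r c a' r' c' : ℤ) (ha : 0 ≤ a) (hr : 1 ≤ r) (hc : 0 ≤ c) (ha' : 0 ≤ a') (hr' : 1 ≤ r')
    (hc' : 0 ≤ c') (hv : (Sst a r c).v = (Sst a' r' c').v) (he : (Sst a r c).e = (Sst a' r' c').e) :
    a = a' ∧ r = r' ∧ c = c' := by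
  simp only [Sst, ones, zeros, stp_t, s0] at hv he
  have h : a = a' := by
    rcases lt_trichotomy a a' with h | h | h
    · obtain ⟨x, rfl⟩ : ∃ x, a' = a + 1 + x := ⟨a' - a - 1, by ring⟩
      obtain ⟨y, rfl⟩ : ∃ y, r' = 1 + y := ⟨r' - 1, by ring⟩
      obtain rfl : r = 2 + x + y + c' - c := by linarith
      have hx : 0 ≤ x := by omega
      have hy : 0 ≤ y := by omega
      nlinarith [mul_nonneg hx hy, mul_nonneg hx hc', mul_nonneg hx hx]
    · exact h
    · obtain ⟨x, rfl⟩ : ∃ x, a = a' + 1 + x := ⟨a - a' - 1, by ring⟩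
      obtain ⟨y, rfl⟩ : ∃ y, r = 1 + y := ⟨r - 1, by ring⟩
      obtain rfl : r' = 2 + x + y + c - c' := by linarith
      have hx : 0 ≤ x := by omega
      have hy : 0 ≤ y := by omega
      nlinarith [mul_nonneg hx hy, mul_nonneg hx hc, mul_nonneg hx hx]
  subst h
  obtain rfl : r' = r + c - c' := by linarith
  have : c = c' := by nlinarith
  subst this
  exact ⟨rfl, by linarith, rfl⟩

lemma C2_not (i b c : ℕ) (hb : 2 ≤ b) (hc : b + 1 ≤ c) :
    ¬ HOptL (Z i ++ true :: (Z b ++ T c)) := by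
  obtain ⟨B, rfl⟩ := Nat.exists_eq_add_of_le' hb
  obtain ⟨k, rfl⟩ := Nat.exists_eq_add_of_le hc
  apply not_HOptL (Z (i+B+1) ++ (T (B+2) ++ false :: T (k+2)))
  · simp; omega
  · simp only [stF, st, run_append, run_cons, run_nil, run_T', run_Z', ones, zeros, stp_t, stp_f, s0, s1]
    push_cast; ring
  · simp only [stF, st, run_append, run_cons, run_nil, run_T', run_Z', ones, zeros, stp_t, stp_f, s0, s1]
    push_cast; ring
  · rw [← sub_pos]
    simp only [stF, st, run_append, run_cons, run_nil, run_T', run_Z', ones, zeros, stp_t, stp_f, s0, s1]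
    push_cast; ring_nf; positivity

lemma S3_not (a r : ℕ) (hr : 2 ≤ r) : ¬ HOptL (T a ++ (Z r ++ [true, true])) := by
  obtain ⟨B, rfl⟩ := Nat.exists_eq_add_of_le' hr
  apply not_HOptL (T a ++ (Z (B+1) ++ true :: Z 2))
  · simp
  · simp only [stF, st, run_append, run_cons, run_nil, run_T', run_Z', ones, zeros, stp_t, stp_f, s0, s1]
    push_cast; ring
  · simp only [stF, st, run_append, run_cons, run_nil, run_T', run_Z', ones, zeros, stp_t, stp_f, s0, s1]
    push_cast; ring
  · rw [← sub_pos]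
    simp only [stF, st, run_append, run_cons, run_nil, run_T', run_Z', ones, zeros, stp_t, stp_f, s0, s1]
    push_cast; ring_nf; positivity

lemma sform {L : List Bool} (hL : L.head? = some true) (h : HOptL L)
    (he : (st L).e ≤ ((L.length:ℤ)) * (L.length - 1)) :
    ∃ a r c : ℕ, 1 ≤ a ∧ 1 ≤ r ∧ (st L).v = (Sst a r c).v ∧ (st L).e = (Sst a r c).e ∧
     (st L).m = (Sst a r c).m ∧ ((st L).h = (Sst a r c).h ∨
       (2 ≤ r ∧ r ≤ a ∧ (st L).h = (Sst a r c).h + gn r c)) := by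
  rcases cls L h.1 with hc | hc
  · rcases hc with ⟨a, r, rfl⟩ | ⟨a, r, c, h1, rfl⟩ | ⟨a, b, c, h1, h3, rfl⟩ | ⟨a, r, h1, rfl⟩
    · rcases a with _ | a
      · rcases r with _ | r <;> simp [List.replicate_succ] at hL
      rcases r with _ | r
      · exfalso
        simp [st, run_append, run_T', run_nil, ones, s1] at he
        nlinarith
      refine ⟨a+1, r+1, 0, by omega, by omega, ?_, ?_, ?_, Or.inl ?_⟩ <;>
      · simp only [st, run_append, run_cons, run_nil, run_T', run_Z', ones, zeros, stp_t, stp_f, s0, s1, Sst]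
        push_cast; ring
    · rcases a with _ | a
      · rcases r with _ | r <;> simp [List.replicate_succ] at hL h1
      refine ⟨a+1, r, c+1, by omega, by omega, ?_, ?_, ?_, Or.inl ?_⟩ <;>
      · simp only [st, run_append, run_cons, run_nil, run_T', run_Z', ones, zeros, stp_t, stp_f, s0, s1, Sst]
        push_cast; ring
    · rcases a with _ | a
      · simp [List.replicate_succ] at hL h1
      obtain ⟨B, rfl⟩ := Nat.exists_eq_add_of_le' h1
      obtain ⟨k, rfl⟩ := Nat.exists_eq_add_of_le h3
      refine ⟨a+1+B+1, B+2, k+3, by omega, by omega, ?_, ?_, ?_, Or.inr ⟨by omega, by omega, ?_⟩⟩ <;>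
      · simp only [st, run_append, run_cons, run_nil, run_T', run_Z', ones, zeros, stp_t, stp_f, s0, s1, Sst, gn]
        push_cast; ring
    · exact absurd h (S3_not a r h1)
  · obtain ⟨M, rfl⟩ : ∃ M, L = cpl M := ⟨cpl L, (cpl_cpl L).symm⟩
    rw [cpl_cpl] at hc
    rcases hc with ⟨a, r, rfl⟩ | ⟨a, r, c, h1, rfl⟩ | ⟨a, b, c, h1, h3, rfl⟩ | ⟨a, r, h1, rfl⟩
    · rcases a with _ | a
      swap
      · simp [List.replicate_succ, cpl] at hL
      exfalso
      simp [st, cpl_app, cpl_T', cpl_Z', cpl_nil, run_append, run_T', run_nil, ones, s1, cpl_length] at he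
      rcases r with _ | r
      · simp [cpl] at hL
      push_cast at he
      nlinarith
    · rcases a with _ | a
      swap
      · simp [List.replicate_succ, cpl] at hL
      exfalso
      simp only [cpl_app, cpl_cons, cpl_T', cpl_Z', cpl_length] at he
      simp only [st, run_append, run_cons, run_nil, run_T', run_Z', ones, zeros, stp_t, stp_f, s0, s1, Bool.not_true, Bool.not_false] at he
      simp at he
      nlinarith
    · rcases a with _ | a
      swap
      · simp [List.replicate_succ, cpl] at hL
      exact absurd h (by simpa [cpl] using C2_not 0 b c h1 h3)
    · rcases a with _ | a
      swap
      · simp [List.replicate_succ, cpl] at hL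
      refine ⟨r, 2, 0, by omega, by omega, ?_, ?_, ?_, Or.inl ?_⟩ <;>
      · simp only [cpl_app, cpl_cons, cpl_nil, cpl_T', cpl_Z', cpl_length]
        simp only [st, run_append, run_cons, run_nil, run_T', run_Z', ones, zeros, stp_t, stp_f, s0, s1, Sst, Bool.not_true, Bool.not_false]
        push_cast; ring

lemma cform {L : List Bool} (hL : L.head? = some false) (h : HOptL L)
    (he : 2 * ((L.length:ℤ)) ≤ (st L).e) :
    (∃ i d j : ℕ, 1 ≤ j ∧ (1 ≤ i ∨ d = 0) ∧ (st L).v = (Cst i d j).v ∧ (st L).e = (Cst i d j).e ∧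
     (st L).m = (Cst i d j).m ∧ (Cst i d j).h ≤ (st L).h) ∨
    ∃ b c : ℕ, 2 ≤ b ∧ b + 1 ≤ c ∧ L = false :: (T b ++ Z c) := by
  rcases cls L h.1 with hc | hc
  · rcases hc with ⟨a, r, rfl⟩ | ⟨a, r, c, h1, rfl⟩ | ⟨a, b, c, h1, h3, rfl⟩ | ⟨a, r, h1, rfl⟩
    · rcases a with _ | a
      swap
      · simp [List.replicate_succ] at hL
      rcases r with _ | r
      · simp at hL
      exfalso
      simp [st, run_append, run_T', run_Z', run_nil, ones, zeros, s1] at he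
      nlinarith
    · rcases a with _ | a
      swap
      · simp [List.replicate_succ] at hL
      exfalso
      simp only [st, run_append, run_cons, run_nil, run_T', run_Z', ones, zeros, stp_t, stp_f, s0, s1] at he
      simp at he
      omega
    · rcases a with _ | a
      swap
      · simp [List.replicate_succ] at hL
      exact Or.inr ⟨b, c, h1, h3, by simp⟩
    · rcases a with _ | a
      swap
      · simp [List.replicate_succ] at hL
      obtain ⟨R, rfl⟩ := Nat.exists_eq_add_of_le' h1
      left
      refine ⟨R+1, 0, 3, by omega, by omega, ?_, ?_, ?_, le_of_eq ?_⟩ <;>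
      · skip
        simp only [st, run_append, run_cons, run_nil, run_T', run_Z', ones, zeros, stp_t, stp_f, s0, s1, Cst, Bool.not_true, Bool.not_false]
        push_cast; ring
  · obtain ⟨M, rfl⟩ : ∃ M, L = cpl M := ⟨cpl L, (cpl_cpl L).symm⟩
    rw [cpl_cpl] at hc
    left
    rcases hc with ⟨a, r, rfl⟩ | ⟨a, r, c, h1, rfl⟩ | ⟨a, b, c, h1, h3, rfl⟩ | ⟨a, r, h1, rfl⟩
    · rcases a with _ | a
      · rcases r with _ | r <;> simp [List.replicate_succ, cpl] at hL
      refine ⟨a, 0, r+1, by omega, by omega, ?_, ?_, ?_, le_of_eq ?_⟩ <;>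
      · simp only [cpl_app, cpl_cons, cpl_nil, cpl_T', cpl_Z', cpl_length]
        simp only [st, run_append, run_cons, run_nil, run_T', run_Z', ones, zeros, stp_t, stp_f, s0, s1, Cst, Bool.not_true, Bool.not_false]
        push_cast; ring
    · rcases a with _ | a
      · rcases r with _ | r <;> simp [List.replicate_succ, cpl] at hL h1
      refine ⟨a+1, r, c+1, by omega, by omega, ?_, ?_, ?_, le_of_eq ?_⟩ <;>
      · simp only [cpl_app, cpl_cons, cpl_nil, cpl_T', cpl_Z', cpl_length]
        simp only [st, run_append, run_cons, run_nil, run_T', run_Z', ones, zeros, stp_t, stp_f, s0, s1, Cst, Bool.not_true, Bool.not_false]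
        push_cast; ring
    · exact absurd h (by simpa [cpl] using C2_not a b c h1 h3)
    · rcases a with _ | a
      · rcases r with _ | r <;> simp [List.replicate_succ, cpl] at hL h1
      obtain ⟨R, rfl⟩ := Nat.exists_eq_add_of_le' h1
      refine ⟨a+1, R+1, 3, by omega, by omega, ?_, ?_, ?_, ?_⟩
      rotate_right
      · rw [← sub_nonneg]
        simp only [cpl_app, cpl_cons, cpl_nil, cpl_T', cpl_Z', cpl_length]
        simp only [st, run_append, run_cons, run_nil, run_T', run_Z', ones, zeros, stp_t, stp_f, s0, s1, Cst, Bool.not_true, Bool.not_false]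
        push_cast; ring_nf; positivity
      all_goals
        simp only [cpl_app, cpl_cons, cpl_nil, cpl_T', cpl_Z', cpl_length]
        simp only [st, run_append, run_cons, run_nil, run_T', run_Z', ones, zeros, stp_t, stp_f, s0, s1, Cst, Bool.not_true, Bool.not_false]
        push_cast; ring

end TL
end

section
namespace TL

lemma st_e_nonneg (L : List Bool) : 0 ≤ (st L).e := by
  induction L with
  | nil => simp [st, run_nil, s1]
  | cons b L ih =>
    have h1 := run_v s1 L
    have hs : s1.v = 1 := rfl
    simp only [st, run_cons] at *
    cases b <;> simp [stp, h1, hs] <;> positivity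

lemma st_e_le (L : List Bool) : (st L).e ≤ (L.length + 1) * L.length := by
  have := cpl_e L
  have := st_e_nonneg (cpl L)
  linarith

def lists : ℕ → List (List Bool)
  | 0 => [[]]
  | n+1 => (lists n).flatMap fun L => [false :: L, true :: L]

lemma mem_lists (L : List Bool) : L ∈ lists L.length := by
  induction L with
  | nil => simp [lists]
  | cons b L ih =>
    simp only [lists, List.length_cons, List.mem_flatMap]
    exact ⟨L, ih, by cases b <;> simp⟩

lemma length_lists {n : ℕ} {L : List Bool} (h : L ∈ lists n) : L.length = n := by
  induction n generalizing L with
  | zero => simp [lists] at h; simp [h]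
  | succ n ih =>
    simp only [lists, List.mem_flatMap] at h
    obtain ⟨M, hM, h⟩ := h
    have := ih hM
    simp at h
    rcases h with rfl | rfl <;> simp [this]

def chkS (A B : List Bool) (n : ℕ) : Bool :=
  let p := st (false :: A)
  let q := st (true :: B)
  !(decide (p.e = q.e) && decide (p.m = q.m) && decide (p.h = q.h)) ||
  (lists (n+1)).any fun C => let w := st C
    decide (w.e = p.e) && (decide (p.m < w.m) || (decide (p.m = w.m) && decide (p.h < w.h)))

def chkSm : Bool := (List.range 6).all fun n => (lists n).all fun A => (lists n).all fun B => chkS A B n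

lemma chkSm_true : chkSm = true := by decide +kernel

lemma HOptL.eqs {L L' : List Bool} (h : HOptL L) (h' : HOptL L') (hl : L.length = L'.length)
    (he : (st L).e = (st L').e) : (st L).m = (st L').m ∧ (st L).h = (st L').h := by
  have hm : (st L).m = (st L').m := le_antisymm (h'.1 L hl he) (h.1 L' hl.symm he.symm)
  exact ⟨hm, le_antisymm (h'.2 L hl he hm) (h.2 L' hl.symm he.symm hm.symm)⟩

lemma heads {A B : List Bool} (h1 : HOptL (false :: A)) (h2 : HOptL (true :: B))
    (hl : A.length = B.length) (he : (st (false :: A)).e = (st (true :: B)).e) : False := by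
  obtain ⟨hm, hh⟩ := h1.eqs h2 (by simp [hl]) he
  rcases Nat.lt_or_ge A.length 6 with h6 | h6
  · have h := chkSm_true
    simp only [chkSm, List.all_eq_true, List.mem_range] at h
    have h := h A.length h6 A (mem_lists A) B (hl ▸ mem_lists B)
    simp only [chkS, he, hm, hh] at h
    simp only [decide_true, Bool.and_self, Bool.not_true, Bool.false_or, List.any_eq_true,
      Bool.and_eq_true, Bool.or_eq_true, decide_eq_true_eq] at h
    obtain ⟨C, hC, h3, h4⟩ := h
    have hCl := length_lists hC
    rcases h4 with h4 | ⟨h4, h5⟩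
    · have := h2.1 C (by simp [hCl, hl]) h3
      omega
    · have := h2.2 C (by simp [hCl, hl]) h3 h4.symm
      omega
  · have e1 : (st (true :: B)).e ≤ ((true :: B).length : ℤ) * ((true :: B).length - 1) := by
      rw [← he]
      have := st_e_le A
      have h3 : (st (false :: A)).e = (st A).e := rfl
      rw [h3, List.length_cons, ← hl]; push_cast; linarith
    have e2 : 2 * ((false :: A).length : ℤ) ≤ (st (false :: A)).e := by
      rw [he]
      have := st_e_nonneg B
      have h3 : (st (true :: B)).e = (st B).e + 2 * (st B).v := rfl
      have h4 : (st B).v = 1 + B.length := run_v s1 B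
      rw [h3, h4, List.length_cons, ← hl]; push_cast; linarith
    have hvv : (st (true :: B)).v = (st (false :: A)).v := by
      rw [st, st, run_v, run_v]; simp [hl]
    have hv8 : 8 ≤ (st (true :: B)).v := by
      rw [st, run_v]; simp [s1]; omega
    obtain ⟨a, r, c, ha, hr, S1, S2, S3, S4⟩ := sform rfl h2 e1
    rcases cform rfl h1 e2 with ⟨i, d, j, hj, hid, C1, C2, C3, C4⟩ | ⟨b, c', hb, hc', hL⟩
    · have := tie a r c i d j (by omega) (by omega) (by omega) (by omega) (by omega) (by omega)
        (by omega) (by rw [← S1, ← C1, hvv]) (by rw [← S1]; exact hv8) (by rw [← S2, ← C2, he])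
        (by rw [← S3, ← C3, hm])
      rcases S4 with S4 | ⟨S5, S6, S7⟩
      · linarith [this.1]
      · linarith [this.2 (by omega) (by omega)]
    · obtain ⟨B', rfl⟩ := Nat.exists_eq_add_of_le' hb
      obtain ⟨k, rfl⟩ := Nat.exists_eq_add_of_le hc'
      rw [hL] at hvv he hm hh
      have t1 : (st (false :: (T (B'+2) ++ Z (B'+2+1+k)))).v = (Sst ((B'+1 : ℕ):ℤ) ((B'+2 : ℕ):ℤ) ((k+3 : ℕ):ℤ)).v := by
        simp only [st, run_append, run_cons, run_nil, run_T', run_Z', ones, zeros, stp_t, stp_f, s0, s1, Sst, gn]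
        push_cast; ring
      have t2 : (st (false :: (T (B'+2) ++ Z (B'+2+1+k)))).e = (Sst ((B'+1 : ℕ):ℤ) ((B'+2 : ℕ):ℤ) ((k+3 : ℕ):ℤ)).e := by
        simp only [st, run_append, run_cons, run_nil, run_T', run_Z', ones, zeros, stp_t, stp_f, s0, s1, Sst, gn]
        push_cast; ring
      have t3 : (Sst ((B'+1 : ℕ):ℤ) ((B'+2 : ℕ):ℤ) ((k+3 : ℕ):ℤ)).h < (st (false :: (T (B'+2) ++ Z (B'+2+1+k)))).h := by
        rw [← sub_pos]
        simp only [st, run_append, run_cons, run_nil, run_T', run_Z', ones, zeros, stp_t, stp_f, s0, s1, Sst, gn]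
        push_cast; ring_nf; positivity
      obtain ⟨q1, q2, q3⟩ := Sst_inj _ _ _ _ _ _ (by omega) (by omega) (by omega) (by omega) (by omega) (by omega)
        (S1.symm.trans (hvv.trans t1)) (S2.symm.trans (he.symm.trans t2))
      rw [q1, q2, q3] at S4
      rcases S4 with S4 | ⟨S5, S6, S7⟩
      · linarith
      · omega

theorem list_unique (L1 L2 : List Bool) (h1 : HOptL L1) (h2 : HOptL L2)
    (hl : L1.length = L2.length) (he : (st L1).e = (st L2).e) : L1 = L2 := by
  induction L1 generalizing L2 with
  | nil => symm; simpa using hl.symm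
  | cons a A ih =>
    cases L2 with
    | nil => simp at hl
    | cons b B =>
      have hl' : A.length = B.length := by simpa using hl
      have hv : (st A).v = (st B).v := by rw [st, st, run_v, run_v, hl']
      have heq : a = b := by
        cases a <;> cases b
        · rfl
        · exact (heads h1 h2 hl' he).elim
        · exact (heads h2 h1 hl'.symm he.symm).elim
        · rfl
      subst heq
      rw [ih B h1.tail h2.tail hl' ?_]
      unfold st at *
      rw [run_cons, run_cons] at he
      cases a <;> simp [stp, hv] at he <;> exact he
end TL
end

section
open Finset

noncomputable section
namespace TL
variable {V : Type} [Fintype V]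

open Classical in
def AA {V : Type} (G : SimpleGraph V) (u v : V) : ℤ := if G.Adj u v then 1 else 0
def dg {V : Type} [Fintype V] (G : SimpleGraph V) (u : V) : ℤ := ∑ v, AA G u v

lemma AA_symm (G : SimpleGraph V) (u v : V) : AA G u v = AA G v u := by
  by_cases h : G.Adj u v
  · simp [AA, h, h.symm]
  · have h' : ¬ G.Adj v u := fun k => h k.symm
    simp [AA, h, h']
lemma AA_self (G : SimpleGraph V) (u : V) : AA G u u = 0 := by simp [AA]
lemma AA_sq (G : SimpleGraph V) (u v : V) : AA G u v * AA G u v = AA G u v := by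
  simp only [AA]; split_ifs <;> simp

lemma dg_eq (G : SimpleGraph V) (u : V) : ((G.neighborSet u).ncard : ℤ) = dg G u := by
  classical
  rw [Set.ncard_eq_toFinset_card', dg]
  simp only [AA]
  rw [Finset.sum_boole]
  congr 2
  ext; simp

lemma two_e (G : SimpleGraph V) : 2 * (edgeCount G : ℤ) = ∑ u, dg G u := by
  classical
  have h := G.sum_degrees_eq_twice_card_edges
  have h2 : edgeCount G = G.edgeFinset.card := by
    rw [edgeCount, Set.ncard_eq_toFinset_card']; rfl
  rw [h2]
  have h3 : ∀ u, (G.degree u : ℤ) = dg G u := fun u => by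
    rw [← dg_eq, Set.ncard_eq_toFinset_card']; rfl
  simp_rw [← h3]
  exact_mod_cast h.symm

lemma M1_eq (G : SimpleGraph V) : (M1 G : ℤ) = ∑ u, dg G u ^ 2 := by
  simp [M1, dg_eq]

lemma even_sum (f : V → V → ℕ) (hs : ∀ u v, f u v = f v u) (h0 : ∀ u, f u u = 0) :
    2 ∣ ∑ u, ∑ v, f u v := by
  classical
  rw [← Finset.sum_product']
  rw [← ZMod.natCast_eq_zero_iff]
  push_cast
  refine Finset.sum_involution (fun x _ => (x.2, x.1)) ?_ ?_ ?_ ?_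
  · intro x _
    simp only
    rw [hs x.2 x.1]
    exact CharTwo.add_self_eq_zero _
  · intro x _ hx heq
    apply hx
    have : x.2 = x.1 := congrArg Prod.fst heq
    rw [this, h0]; simp
  · intro x _; simp
  · intro x _; rfl

lemma two_M2 (G : SimpleGraph V) : 2 * (M2 G : ℤ) = ∑ u, ∑ v, AA G u v * dg G u * dg G v := by
  classical
  have h := Nat.mul_div_cancel' (even_sum (fun u v => if G.Adj u v then (G.neighborSet u).ncard * (G.neighborSet v).ncard else 0)
    (fun u v => by simp [G.adj_comm, mul_comm]) (fun u => by simp))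
  have h2 := congrArg (fun x : ℕ => (x : ℤ)) h
  simp only [Nat.cast_mul] at h2
  rw [M2]
  push_cast at h2 ⊢
  convert h2 using 1
  · refine Finset.sum_congr rfl fun u _ => Finset.sum_congr rfl fun v _ => ?_
    simp only [AA, dg_eq]
    split_ifs <;> simp

lemma card_fiber {a b c : V} [DecidableEq V] (h1 : a ≠ b) (h2 : a ≠ c) (h3 : b ≠ c) :
    ((univ : Finset (V × V × V)).filter fun x => ({x.1, x.2.1, x.2.2} : Finset V) = {a, b, c}).card = 6 := by
  have : ((univ : Finset (V × V × V)).filter fun x => ({x.1, x.2.1, x.2.2} : Finset V) = {a, b, c}) =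
    {(a,b,c),(a,c,b),(b,a,c),(b,c,a),(c,a,b),(c,b,a)} := by
    ext ⟨x, y, z⟩
    simp only [mem_filter, mem_univ, true_and, mem_insert, mem_singleton, Prod.mk.injEq]
    constructor
    · intro h
      have hx : x = a ∨ x = b ∨ x = c := by have : x ∈ ({a,b,c} : Finset V) := by rw [← h]; simp
                                            simpa using this
      have hy : y = a ∨ y = b ∨ y = c := by have : y ∈ ({a,b,c} : Finset V) := by rw [← h]; simp
                                            simpa using this
      have hz : z = a ∨ z = b ∨ z = c := by have : z ∈ ({a,b,c} : Finset V) := by rw [← h]; simp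
                                            simpa using this
      have ha : a = x ∨ a = y ∨ a = z := by have : a ∈ ({x,y,z} : Finset V) := by rw [h]; simp
                                            simpa using this
      have hb : b = x ∨ b = y ∨ b = z := by have : b ∈ ({x,y,z} : Finset V) := by rw [h]; simp
                                            simpa using this
      have hc : c = x ∨ c = y ∨ c = z := by have : c ∈ ({x,y,z} : Finset V) := by rw [h]; simp
                                            simpa using this
      grind
    · intro h
      rcases h with ⟨rfl, rfl, rfl⟩ | ⟨rfl, rfl, rfl⟩ | ⟨rfl, rfl, rfl⟩ | ⟨rfl, rfl, rfl⟩ | ⟨rfl, rfl, rfl⟩ | ⟨rfl, rfl, rfl⟩ <;>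
      · ext w; simp; try tauto
  rw [this]
  rw [card_insert_of_notMem, card_insert_of_notMem, card_insert_of_notMem, card_insert_of_notMem, card_insert_of_notMem, card_singleton] <;>
  simp [h1, h2, h3, h1.symm, h2.symm, h3.symm]

lemma six_k3 (G : SimpleGraph V) : 6 * (k3 G : ℤ) = ∑ u, ∑ v, ∑ w, AA G u v * AA G v w * AA G u w := by
  classical
  have e1 : ∑ u, ∑ v, ∑ w, AA G u v * AA G v w * AA G u w =
     ((univ : Finset (V × V × V)).filter fun x => G.Adj x.1 x.2.1 ∧ G.Adj x.2.1 x.2.2 ∧ G.Adj x.1 x.2.2).card := by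
    rw [Finset.card_filter]
    push_cast
    rw [Fintype.sum_prod_type]
    refine Finset.sum_congr rfl fun u _ => ?_
    rw [Fintype.sum_prod_type]
    refine Finset.sum_congr rfl fun v _ => Finset.sum_congr rfl fun w _ => ?_
    simp only [AA]
    split_ifs <;> simp_all
  have e2 : k3 G = ((univ : Finset (Finset V)).filter fun s => G.IsNClique 3 s).card := by
    rw [k3, Set.ncard_eq_toFinset_card']
    congr 1; ext; simp
  rw [e1, e2]
  rw [Finset.card_eq_sum_card_fiberwise (f := fun x : V × V × V => ({x.1, x.2.1, x.2.2} : Finset V))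
    (t := ((univ : Finset (Finset V)).filter fun s => G.IsNClique 3 s))]
  · rw [Finset.sum_congr rfl (g := fun _ => 6)]
    · simp [mul_comm]
    · intro s hs
      simp only [mem_filter, mem_univ, true_and] at hs
      rw [SimpleGraph.is3Clique_iff] at hs
      obtain ⟨a, b, c, h1, h2, h3, rfl⟩ := hs
      rw [← card_fiber h1.ne h2.ne h3.ne]
      congr 1
      ext ⟨x, y, z⟩
      simp only [mem_filter, mem_univ, true_and]
      constructor
      · exact fun h => h.2
      · intro h
        refine ⟨?_, h⟩
        have h4 : G.IsNClique 3 {x, y, z} := by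
          rw [h]; exact SimpleGraph.is3Clique_triple_iff.2 ⟨h1, h2, h3⟩
        have := SimpleGraph.is3Clique_triple_iff.1 h4
        exact ⟨this.1, this.2.2, this.2.1⟩
  · intro x hx
    simp only [coe_filter, mem_univ, true_and, Set.mem_ofPred_eq] at hx ⊢
    exact SimpleGraph.is3Clique_triple_iff.2 ⟨hx.1, hx.2.2, hx.2.1⟩

end TL
end
end

section
open Finset
noncomputable section
namespace TL

def s2 {V : Type} [Fintype V] (G : SimpleGraph V) : ℤ := ∑ u, dg G u
def sM {V : Type} [Fintype V] (G : SimpleGraph V) : ℤ := ∑ u, dg G u ^ 2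
def sP {V : Type} [Fintype V] (G : SimpleGraph V) : ℤ := ∑ u, ∑ v, AA G u v * dg G u * dg G v
def sT {V : Type} [Fintype V] (G : SimpleGraph V) : ℤ :=
  ∑ u, ∑ v, ∑ w, AA G u v * AA G v w * AA G u w

lemma two_H {V : Type} [Fintype V] (G : SimpleGraph V) : 2 * Hval G = sP G - 2 * sT G := by
  rw [Hval, sP, sT, ← two_M2, ← six_k3]; ring

lemma sAd {V : Type} [Fintype V] (G : SimpleGraph V) : ∑ u, ∑ v, AA G u v * dg G u = sM G := by
  rw [sM]; refine sum_congr rfl fun u _ => ?_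
  rw [← sum_mul, ← dg]; ring

lemma sAd' {V : Type} [Fintype V] (G : SimpleGraph V) : ∑ u, ∑ v, AA G u v * dg G v = sM G := by
  rw [sum_comm, ← sAd]
  refine sum_congr rfl fun u _ => sum_congr rfl fun v _ => ?_
  rw [AA_symm]

section
variable {V : Type} [Fintype V] (G : SimpleGraph V) (x : V) [Fintype {y // y ≠ x}] (β : ℤ)

def rem : SimpleGraph {y // y ≠ x} := G.comap Subtype.val

lemma sum_split (f : V → ℤ) : ∑ v, f v = f x + ∑ w : {y // y ≠ x}, f w := by
  classical
  rw [Fintype.sum_eq_add_sum_subtype_ne f x]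
  congr!

lemma AA_rem (u v : {y // y ≠ x}) : AA (rem G x) u v = AA G u v := rfl

variable (hx : ∀ y ≠ x, AA G x y = β)
include hx

lemma dg_x : dg G x = β * Fintype.card {y // y ≠ x} := by
  have h : ∀ w : {y // y ≠ x}, AA G x w = β := fun w => hx w w.2
  rw [dg, sum_split x, AA_self]
  simp [h, mul_comm]

lemma dg_w (w : {y // y ≠ x}) : dg G w = β + dg (rem G x) w := by
  rw [dg, sum_split x, AA_symm, hx w w.2]; rfl

lemma s2_rec : s2 G = s2 (rem G x) + 2 * β * Fintype.card {y // y ≠ x} := by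
  rw [s2, sum_split x, dg_x G x β hx, sum_congr rfl (fun w _ => dg_w G x β hx w), sum_add_distrib, s2]
  simp; ring

lemma sM_rec : sM G = sM (rem G x) + 2 * β * s2 (rem G x) + β ^ 2 * Fintype.card {y // y ≠ x}
    + β ^ 2 * Fintype.card {y // y ≠ x} ^ 2 := by
  rw [sM, sum_split x, dg_x G x β hx]
  have : ∀ w : {y // y ≠ x}, dg G w ^ 2 = β^2 + (2*β*dg (rem G x) w + dg (rem G x) w ^ 2) := fun w => by
    rw [dg_w G x β hx]; ring
  rw [sum_congr rfl (fun w _ => this w), sum_add_distrib, sum_add_distrib, ← mul_sum]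
  rw [s2, sM]
  simp; ring

lemma sP_rec : sP G = sP (rem G x) + 2 * β * sM (rem G x) + β ^ 2 * s2 (rem G x)
    + 2 * β ^ 2 * Fintype.card {y // y ≠ x} * (β * Fintype.card {y // y ≠ x} + s2 (rem G x)) := by
  have h1 : ∀ w : {y // y ≠ x}, ∑ v, AA G w v * dg G w * dg G v =
     β * (β * Fintype.card {y // y ≠ x}) * (β + dg (rem G x) w)
     + ∑ v : {y // y ≠ x}, (β^2 * AA (rem G x) w v + (β * (AA (rem G x) w v * dg (rem G x) w) +
       (β * (AA (rem G x) w v * dg (rem G x) v) + AA (rem G x) w v * dg (rem G x) w * dg (rem G x) v))) := by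
    intro w
    rw [sum_split x, AA_symm, hx w w.2, dg_x G x β hx, dg_w G x β hx]
    congr 1
    · ring
    · refine sum_congr rfl fun v _ => ?_
      rw [dg_w G x β hx, AA_rem]; ring
  rw [sP, sum_split x, sum_split x, AA_self, sum_congr rfl (fun w _ => h1 w)]
  simp only [sum_add_distrib, ← mul_sum]
  rw [sAd, sAd']
  have h2 : ∑ v : {y // y ≠ x}, AA G x v * dg G x * dg G v =
     β * (β * Fintype.card {y // y ≠ x}) * ∑ v : {y // y ≠ x}, (β + dg (rem G x) v) := by
    rw [mul_sum]
    refine sum_congr rfl fun v _ => ?_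
    rw [hx v v.2, dg_x G x β hx, dg_w G x β hx]
  rw [h2, sum_add_distrib]
  have h3 : ∑ i, ∑ v, AA (rem G x) i v = s2 (rem G x) := rfl
  rw [h3, ← s2, ← sP]
  simp; ring

lemma sT_rec : sT G = sT (rem G x) + 3 * β ^ 2 * s2 (rem G x) := by
  have hx' : ∀ y : {y // y ≠ x}, AA G y x = β := fun y => by rw [AA_symm, hx y y.2]
  have hx2 : ∀ y : {y // y ≠ x}, AA G x y = β := fun y => hx y y.2
  have h3 : ∑ i, ∑ v, AA (rem G x) i v = s2 (rem G x) := rfl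
  rw [sT, sum_split x]
  have e1 : ∑ v, ∑ w, AA G x v * AA G v w * AA G x w = β^2 * s2 (rem G x) := by
    rw [sum_split x, ← h3, mul_sum]
    simp only [AA_self, zero_mul, sum_const_zero, zero_add]
    refine sum_congr rfl fun u _ => ?_
    rw [sum_split x, AA_self, mul_zero, zero_add, mul_sum]
    refine sum_congr rfl fun v _ => ?_
    rw [hx2, hx2, AA_rem]; ring
  have e2 : ∀ u : {y // y ≠ x}, ∑ v, ∑ w, AA G u v * AA G v w * AA G u w =
     (∑ w, β^2 * AA (rem G x) u w) + ∑ v, (β^2 * AA (rem G x) u v + ∑ w, AA (rem G x) u v * AA (rem G x) v w * AA (rem G x) u w) := by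
    intro u
    rw [sum_split x]
    congr 1
    · rw [sum_split x, AA_self, mul_zero, zero_mul, zero_add]
      refine sum_congr rfl fun v _ => ?_
      rw [hx', hx2, AA_rem]; ring
    · refine sum_congr rfl fun v _ => ?_
      rw [sum_split x, hx', hx']
      congr 1
      rw [AA_rem]; ring
  rw [e1, sum_congr rfl (fun u _ => e2 u)]
  simp only [sum_add_distrib, ← mul_sum]
  rw [h3, sT]; ring

end
end TL
end
end

section
open Finset
noncomputable section
namespace TL

def Builds : List Bool → (V : Type) → SimpleGraph V → Prop
  | [], V, _ => ∃ x : V, ∀ y : V, y = x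
  | b :: L, V, G => ∃ x : V, (∀ y, y ≠ x → (G.Adj x y ↔ b = true)) ∧ Builds L {y // y ≠ x} (rem G x)

lemma builds_iso (L : List Bool) : ∀ (V W : Type) (G : SimpleGraph V) (H : SimpleGraph W),
    Builds L V G → Builds L W H → Nonempty (G ≃g H) := by
  classical
  induction L with
  | nil =>
    rintro V W G H ⟨x, hx⟩ ⟨y, hy⟩
    refine ⟨⟨⟨fun _ => y, fun _ => x, fun a => (hx a).symm, fun a => (hy a).symm⟩, ?_⟩⟩
    intro a b
    simp [hx a, hx b]
  | cons c L ih =>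
    rintro V W G H ⟨x, hx, hB⟩ ⟨y, hy, hC⟩
    obtain ⟨e⟩ := ih _ _ _ _ hB hC
    let φ : V ≃ W := (Equiv.optionSubtypeNe x).symm.trans
      ((Equiv.optionCongr e.toEquiv).trans (Equiv.optionSubtypeNe y))
    have h0 : φ x = y := by simp [φ]
    have h1 : ∀ w : {z // z ≠ x}, φ w = e w := fun w => by simp [φ, w.2]
    refine ⟨⟨φ, ?_⟩⟩
    intro a b
    by_cases ha : a = x
    · subst ha
      by_cases hb : b = a
      · subst hb; simp
      · have := (e ⟨b, hb⟩).2
        rw [h0, h1 ⟨b, hb⟩, hy _ this, hx _ hb]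
    · by_cases hb : b = x
      · subst hb
        have := (e ⟨a, ha⟩).2
        rw [h0, h1 ⟨a, ha⟩, H.adj_comm, G.adj_comm, hy _ this, hx _ ha]
      · rw [h1 ⟨a, ha⟩, h1 ⟨b, hb⟩]
        exact e.map_adj_iff (v := ⟨a, ha⟩) (w := ⟨b, hb⟩)

def ext {V : Type} (x : V) (b : Bool) (G : SimpleGraph {y // y ≠ x}) : SimpleGraph V where
  Adj y z := y ≠ z ∧ ((∃ hy hz, G.Adj ⟨y, hy⟩ ⟨z, hz⟩) ∨ (b = true ∧ (y = x ∨ z = x)))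
  symm := ⟨by
    rintro y z ⟨h, h'⟩
    refine ⟨h.symm, ?_⟩
    rcases h' with ⟨hy, hz, h'⟩ | ⟨h1, h2⟩
    · exact Or.inl ⟨hz, hy, h'.symm⟩
    · exact Or.inr ⟨h1, h2.symm⟩⟩
  loopless := ⟨by rintro y ⟨h, _⟩; exact h rfl⟩

lemma ext_adj {V : Type} (x : V) (b : Bool) (G : SimpleGraph {y // y ≠ x}) (y : V) (hy : y ≠ x) :
    (ext x b G).Adj x y ↔ b = true := by
  simp [ext, hy.symm]

lemma ext_rem {V : Type} (x : V) (b : Bool) (G : SimpleGraph {y // y ≠ x}) :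
    rem (ext x b G) x = G := by
  ext ⟨y, hy⟩ ⟨z, hz⟩
  simp only [rem, SimpleGraph.comap_adj, ext, hy, hz]
  constructor
  · rintro ⟨h, ⟨_, _, h'⟩ | h'⟩
    · exact h'
    · simp at h'
  · intro h
    refine ⟨fun k => ?_, Or.inl ⟨hy, hz, h⟩⟩
    subst k
    exact G.loopless.irrefl _ h

lemma builds_exists (L : List Bool) : ∀ (V : Type) [Fintype V], Fintype.card V = L.length + 1 →
    ∃ G, Builds L V G := by
  classical
  induction L with
  | nil =>
    intro V _ h
    obtain ⟨x, hx⟩ := Fintype.card_eq_one_iff.1 (by simpa using h)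
    exact ⟨⊥, x, hx⟩
  | cons b L ih =>
    intro V _ h
    have : Nonempty V := Fintype.card_pos_iff.1 (by omega)
    obtain ⟨x⟩ := this
    obtain ⟨G, hG⟩ := ih {y // y ≠ x} (by
      rw [Fintype.card_subtype_compl, h]; simp)
    refine ⟨ext x b G, x, ext_adj x b G, ?_⟩
    rwa [ext_rem]

lemma adj_AA {V : Type} [Fintype V] (G : SimpleGraph V) (x : V) (b : Bool)
    (hx : ∀ y, y ≠ x → (G.Adj x y ↔ b = true)) : ∀ y ≠ x, AA G x y = if b then 1 else 0 := by
  intro y hy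
  simp [AA, hx y hy]

lemma card_ne {V : Type} [Fintype V] (x : V) [Fintype {y // y ≠ x}] :
    (Fintype.card V : ℤ) = Fintype.card {y // y ≠ x} + 1 := by
  have := sum_split x (fun _ : V => (1:ℤ))
  simp only [sum_const, card_univ, nsmul_eq_mul, mul_one] at this
  linarith

lemma builds_st (L : List Bool) : ∀ (V : Type) [Fintype V] (G : SimpleGraph V), Builds L V G →
    (Fintype.card V : ℤ) = (st L).v ∧ s2 G = (st L).e ∧ sM G = (st L).m ∧
      sP G - 2 * sT G = (st L).h := by
  classical
  induction L with
  | nil =>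
    rintro V _ G ⟨x, hx⟩
    have h0 : ∀ u v, AA G u v = 0 := fun u v => by rw [hx u, hx v, AA_self]
    have h1 : ∀ u, dg G u = 0 := fun u => by simp [dg, h0]
    refine ⟨?_, ?_, ?_, ?_⟩
    · rw [Fintype.card_eq_one_iff.2 ⟨x, hx⟩]; rfl
    · simp [s2, h1]; rfl
    · simp [sM, h1]; rfl
    · simp [sP, sT, h1, h0]; rfl
  | cons b L ih =>
    rintro V _ G ⟨x, hx, hB⟩
    have hA := adj_AA G x b hx
    obtain ⟨a1, a2, a3, a4⟩ := ih _ _ hB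
    have e : st (b :: L) = stp b (st L) := rfl
    rw [e, card_ne x, s2_rec G x _ hA, sM_rec G x _ hA, sP_rec G x _ hA, sT_rec G x _ hA, a1, a2, a3]
    have a5 : sP (rem G x) = (st L).h + 2 * sT (rem G x) := by linarith
    rw [a5]
    cases b
    · simp [stp]
    · simp only [stp, if_true]
      refine ⟨trivial, by ring, by ring, by ring⟩

lemma s2_e {V : Type} [Fintype V] (G : SimpleGraph V) : s2 G = 2 * (edgeCount G : ℤ) := (two_e G).symm
lemma sM_e {V : Type} [Fintype V] (G : SimpleGraph V) : sM G = (M1 G : ℤ) := (M1_eq G).symm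

lemma switch {V : Type} [Fintype V] (m : ℕ) (G : SimpleGraph V) (hG : MOptimal m G) (a b w : V)
    (hab : a ≠ b) (hd : dg G b ≤ dg G a) (hbw : G.Adj b w) (hwa : w ≠ a) (haw : ¬ G.Adj a w) : False := by
  classical
  let G' := SimpleGraph.fromEdgeSet (insert s(a,w) (G.edgeSet \ {s(b,w)}))
  have hw : b ≠ w := hbw.ne
  have hE : edgeCount G' = edgeCount G := by
    simp only [edgeCount, G', SimpleGraph.edgeSet_fromEdgeSet]
    rw [← Set.ncard_exchange (s := G.edgeSet) (a := s(a,w)) (b := s(b,w)) (by simpa) (by simpa)]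
    congr 1
    ext e
    simp only [Set.mem_sdiff, Set.mem_insert_iff]
    constructor
    · exact fun h => h.1
    · intro h
      refine ⟨h, ?_⟩
      rcases h with h | h
      · subst h; simpa [Sym2.mem_diagSet] using hwa.symm
      · exact fun k => G.not_isDiag_of_mem_edgeSet h.1 k
  have hA : ∀ u v, AA G' u v = AA G u v + ((if u = a then 1 else 0) * (if v = w then 1 else 0) +
      (if u = w then 1 else 0) * (if v = a then 1 else 0)) - ((if u = b then 1 else 0) * (if v = w then 1 else 0) +
      (if u = w then 1 else 0) * (if v = b then 1 else 0)) := by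
    intro u v
    have h1 : G'.Adj u v ↔ ((u = a ∧ v = w ∨ u = w ∧ v = a) ∨ (G.Adj u v ∧ ¬ (u = b ∧ v = w ∨ u = w ∧ v = b))) := by
      simp only [G', SimpleGraph.fromEdgeSet_adj, Set.mem_insert_iff, Set.mem_sdiff, Set.mem_singleton_iff,
        SimpleGraph.mem_edgeSet, Sym2.eq_iff]
      constructor
      · exact fun h => h.1
      · intro h
        refine ⟨h, ?_⟩
        rcases h with (⟨rfl, rfl⟩ | ⟨rfl, rfl⟩) | h
        · exact hwa.symm
        · exact hwa
        · exact h.1.ne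
    have haw' : ¬ G.Adj w a := fun k => haw k.symm
    simp only [AA, h1]
    by_cases u1 : u = w
    · subst u1
      by_cases v1 : v = a
      · subst v1; simp [hwa, haw', hab, hw.symm]
      · by_cases v2 : v = b
        · subst v2; simp [hwa, hab.symm, hw, hbw.symm]
        · simp [hwa, v1, v2, hw.symm]
    · by_cases u2 : u = a
      · subst u2
        by_cases v1 : v = w
        · subst v1; simp [hab, haw, hwa, hw.symm]
        · simp [u1, v1, hab]
      · by_cases u3 : u = b
        · subst u3
          by_cases v1 : v = w
          · subst v1; simp [hab.symm, hbw, hw]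
          · simp [u1, u2, v1]
        · simp [u1, u2, u3]
  have hD : ∀ u, dg G' u = dg G u + (if u = a then 1 else 0) - (if u = b then 1 else 0) := by
    intro u
    simp only [dg, hA, sum_add_distrib, sum_sub_distrib, ← mul_sum]
    simp
    ring
  have hM : sM G' = sM G + 2 * dg G a - 2 * dg G b + 2 := by
    have : ∀ u, dg G' u ^ 2 = dg G u ^ 2 + (if u = a then 2 * dg G u + 1 else 0) +
        (if u = b then 1 - 2 * dg G u else 0) := by
      intro u
      rw [hD]
      by_cases h1 : u = a
      · subst h1; simp [hab]; ring
      · by_cases h2 : u = b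
        · subst h2; simp [h1]; ring
        · simp [h1, h2]
    simp only [sM, this, sum_add_distrib]
    simp; ring
  have := hG.2 G' (hE.trans hG.1)
  rw [sM_e, sM_e] at hM
  have : (M1 G' : ℤ) ≤ M1 G := by exact_mod_cast this
  linarith

lemma mopt_vertex {V : Type} [Fintype V] [Nonempty V] (m : ℕ) (G : SimpleGraph V) (hG : MOptimal m G) :
    ∃ (x : V) (b : Bool), ∀ y, y ≠ x → (G.Adj x y ↔ b = true) := by
  classical
  obtain ⟨x, hx⟩ := Finite.exists_max (dg G)
  by_cases h : ∀ y, y ≠ x → G.Adj x y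
  · exact ⟨x, true, fun y hy => by simp [h y hy]⟩
  · push Not at h
    obtain ⟨y, hy, hxy⟩ := h
    refine ⟨y, false, fun w hw => ?_⟩
    simp only [Bool.false_eq_true, iff_false]
    intro k
    have : x ≠ w := by rintro rfl; exact hxy k.symm
    exact switch m G hG x w y this (hx w) k.symm hy hxy

lemma mopt_rem {V : Type} [Fintype V] (m : ℕ) (G : SimpleGraph V) (hG : MOptimal m G)
    (x : V) [Fintype {y // y ≠ x}] (b : Bool) (hx : ∀ y, y ≠ x → (G.Adj x y ↔ b = true)) :
    MOptimal (edgeCount (rem G x)) (rem G x) := by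
  refine ⟨rfl, fun G' hG' => ?_⟩
  have hA := adj_AA G x b hx
  have hA' := adj_AA (ext x b G') x b (ext_adj x b G')
  have e1 := s2_rec _ x _ hA
  have e2 := s2_rec _ x _ hA'
  have e3 := sM_rec _ x _ hA
  have e4 := sM_rec _ x _ hA'
  rw [ext_rem] at e2 e4
  have e5 : s2 G' = s2 (rem G x) := by rw [s2_e, s2_e, hG']
  have e6 : edgeCount (ext x b G') = edgeCount G := by
    have : s2 (ext x b G') = s2 G := by rw [e1, e2, e5]
    rw [s2_e, s2_e] at this
    omega
  have := hG.2 _ (e6.trans hG.1)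
  have : (M1 (ext x b G') : ℤ) ≤ M1 G := by exact_mod_cast this
  rw [← sM_e, ← sM_e, e3, e4, e5] at this
  have : sM G' ≤ sM (rem G x) := by linarith
  rw [sM_e, sM_e] at this
  exact_mod_cast this

lemma mopt_builds (k : ℕ) : ∀ (V : Type) [Fintype V] (m : ℕ) (G : SimpleGraph V), Fintype.card V = k + 1 →
    MOptimal m G → ∃ L, Builds L V G := by
  classical
  induction k with
  | zero =>
    intro V _ m G h _
    obtain ⟨x, hx⟩ := Fintype.card_eq_one_iff.1 (by simpa using h)
    exact ⟨[], x, hx⟩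
  | succ k ih =>
    intro V _ m G h hG
    have : Nonempty V := Fintype.card_pos_iff.1 (by omega)
    obtain ⟨x, b, hx⟩ := mopt_vertex m G hG
    obtain ⟨L, hL⟩ := ih {y // y ≠ x} _ (rem G x) (by have := card_ne x; omega) (mopt_rem m G hG x b hx)
    exact ⟨b :: L, x, hx, hL⟩

lemma hopt_list {V : Type} [Fintype V] (m : ℕ) (G : SimpleGraph V) (hG : HOptimal m G) (L : List Bool)
    (hL : Builds L V G) : HOptL L := by
  obtain ⟨a1, a2, a3, a4⟩ := builds_st L V G hL
  have hv : ∀ L, (st L).v = 1 + L.length := fun L => run_v s1 L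
  have key : ∀ L' : List Bool, L'.length = L.length → (st L').e = (st L).e →
      ∃ G', Builds L' V G' ∧ edgeCount G' = m := by
    intro L' hl he
    obtain ⟨G', hG'⟩ := builds_exists L' V (by rw [hv] at a1; omega)
    obtain ⟨b1, b2, b3, b4⟩ := builds_st L' V G' hG'
    refine ⟨G', hG', ?_⟩
    have := hG.1.1
    rw [s2_e] at a2 b2
    omega
  refine ⟨fun L' hl he => ?_, fun L' hl he hm => ?_⟩
  · obtain ⟨G', hG', h⟩ := key L' hl he
    obtain ⟨b1, b2, b3, b4⟩ := builds_st L' V G' hG'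
    have := hG.1.2 G' h
    rw [← a3, ← b3, sM_e, sM_e]
    exact_mod_cast this
  · obtain ⟨G', hG', h⟩ := key L' hl he
    obtain ⟨b1, b2, b3, b4⟩ := builds_st L' V G' hG'
    have hM : M1 G' = M1 G := by
      have : sM G' = sM G := by rw [a3, b3, hm]
      rw [sM_e, sM_e] at this
      exact_mod_cast this
    have := hG.2 G' ⟨h, fun G'' h'' => hM ▸ hG.1.2 G'' h''⟩
    rw [← a4, ← b4, ← two_H, ← two_H]
    linarith

theorem hopt_unique {V W : Type} [Fintype V] [Fintype W] [Nonempty V] (m : ℕ) (G : SimpleGraph V)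
    (H : SimpleGraph W) (hG : HOptimal m G) (hH : HOptimal m H) (hc : Fintype.card V = Fintype.card W) :
    Nonempty (G ≃g H) := by
  have hp : 0 < Fintype.card V := Fintype.card_pos
  obtain ⟨k, hk⟩ : ∃ k, Fintype.card V = k + 1 := ⟨Fintype.card V - 1, by omega⟩
  obtain ⟨L, hL⟩ := mopt_builds k V m G hk hG.1
  obtain ⟨L', hL'⟩ := mopt_builds k W m H (hc ▸ hk) hH.1
  obtain ⟨a1, a2, a3, a4⟩ := builds_st L V G hL
  obtain ⟨b1, b2, b3, b4⟩ := builds_st L' W H hL'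
  have hv : ∀ L, (st L).v = 1 + L.length := fun L => run_v s1 L
  have : L = L' := by
    apply list_unique L L' (hopt_list m G hG L hL) (hopt_list m H hH L' hL')
    · rw [hv] at a1 b1
      omega
    · rw [← a2, ← b2, s2_e, s2_e, hG.1.1, hH.1.1]
  subst this
  exact builds_iso L V W G H hL hL'

end TL
end
end

section
open Finset
noncomputable section
namespace TL

lemma poly_pos (m k : ℕ) (c : ℕ → ℝ) (hk : 1 ≤ k) (hkm : k ≤ m) (h0 : ∀ j, j < k → 1 ≤ j → c j = 0)
    (hc : 0 < c k) : ∃ δ > 0, ∀ p ∈ Set.Ioo (0:ℝ) δ,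
      0 < ∑ i ∈ Finset.Icc 1 m, c i * p ^ i * (1 - p) ^ (m - i) := by
  let g : ℝ → ℝ := fun p => ∑ i ∈ Finset.Icc k m, c i * p ^ (i - k) * (1 - p) ^ (m - i)
  have hg : Continuous g := by fun_prop
  have hg0 : g 0 = c k := by
    simp only [g]
    rw [Finset.sum_eq_single k]
    · simp
    · intro b hb hbk
      have : b - k ≠ 0 := by simp at hb; omega
      simp [this]
    · intro h; simp at h; omega
  have hev : ∀ᶠ p in nhds (0:ℝ), 0 < g p := hg.continuousAt.eventually (lt_mem_nhds (by rw [hg0]; exact hc))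
  obtain ⟨δ, hδ, h⟩ := Metric.eventually_nhds_iff.1 hev
  refine ⟨δ, hδ, fun p hp => ?_⟩
  have h1 := h (y := p) (by rw [Real.dist_eq, sub_zero, abs_of_pos hp.1]; exact hp.2)
  have : ∑ i ∈ Finset.Icc 1 m, c i * p ^ i * (1 - p) ^ (m - i) = p ^ k * g p := by
    simp only [g]
    rw [Finset.mul_sum]
    symm
    apply Finset.sum_subset_zero_on_sdiff
    · exact Finset.Icc_subset_Icc_left hk
    · intro x hx
      simp only [Finset.mem_sdiff, Finset.mem_Icc] at hx
      rw [h0 x (by omega) (by omega)]; simp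
    · intro x hx
      simp only [Finset.mem_Icc] at hx
      have : p ^ x = p ^ k * p ^ (x - k) := by rw [← pow_add]; congr 1; omega
      rw [this]; ring
  rw [this]
  exact mul_pos (pow_pos hp.1 k) h1

lemma relia_lt {n : ℕ} (m k : ℕ) (G H : TwoTerminalGraph n) (hk : 1 ≤ k) (hkm : k ≤ m)
    (h0 : ∀ j, j < k → 1 ≤ j → Ncoeff H j = Ncoeff G j) (hc : Ncoeff H k < Ncoeff G k) :
    ∃ δ > 0, ∀ p ∈ Set.Ioo (0:ℝ) δ, relia m H p < relia m G p := by
  obtain ⟨δ, hδ, h⟩ := poly_pos m k (fun i => (Ncoeff G i : ℝ) - Ncoeff H i) hk hkm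
    (fun j h1 h2 => by simp [h0 j h1 h2]) (by simpa using hc)
  refine ⟨δ, hδ, fun p hp => ?_⟩
  have := h p hp
  simp only [sub_mul, Finset.sum_sub_distrib] at this
  simp only [relia]
  linarith

end TL
end
end

section
open Finset
open scoped Classical
noncomputable section
namespace TL

def rc {V : Type} (F : Finset (Sym2 V)) (a b : V) : Prop :=
  (SimpleGraph.fromEdgeSet (F : Set (Sym2 V))).Reachable a b

section
variable {V : Type} [DecidableEq V]

lemma rc_refl (F : Finset (Sym2 V)) (a : V) : rc F a a := SimpleGraph.Reachable.refl a

lemma rc_adj (F : Finset (Sym2 V)) (a b : V) (h : s(a,b) ∈ F) : rc F a b := by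
  by_cases hab : a = b
  · subst hab; exact rc_refl F a
  · exact SimpleGraph.Adj.reachable (by simp [SimpleGraph.fromEdgeSet_adj, h, hab])

lemma rc_symm {F : Finset (Sym2 V)} {a b : V} (h : rc F a b) : rc F b a := SimpleGraph.Reachable.symm h
lemma rc_trans {F : Finset (Sym2 V)} {a b c : V} (h : rc F a b) (h' : rc F b c) : rc F a c :=
  SimpleGraph.Reachable.trans h h'

lemma rc_mono {F F' : Finset (Sym2 V)} (hF : F ⊆ F') {a b : V} (h : rc F a b) : rc F' a b :=
  SimpleGraph.Reachable.mono (SimpleGraph.fromEdgeSet_mono (by exact_mod_cast hF)) h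

lemma rc_closed (F : Finset (Sym2 V)) (a b : V) (S : V → Prop) (hS : ∀ u v, s(u,v) ∈ F → S u → S v)
    (h : rc F a b) (ha : S a) : S b := by
  obtain ⟨p⟩ := h
  induction p with
  | nil => exact ha
  | cons h p ih =>
    apply ih
    rw [SimpleGraph.fromEdgeSet_adj] at h
    exact hS _ _ (by exact_mod_cast h.1) ha

lemma rc_map (σ : Equiv.Perm V) (F : Finset (Sym2 V)) (a b : V) :
    rc (F.image (Sym2.map σ)) (σ a) (σ b) ↔ rc F a b := by
  have key : ∀ (σ : Equiv.Perm V) (F : Finset (Sym2 V)) (a b : V), rc F a b →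
      rc (F.image (Sym2.map σ)) (σ a) (σ b) := by
    intro σ F a b h
    refine rc_closed F a b (fun v => rc (F.image (Sym2.map σ)) (σ a) (σ v)) ?_ h (rc_refl _ _)
    intro u v huv hu
    refine rc_trans hu (rc_adj _ _ _ ?_)
    rw [mem_image]
    exact ⟨_, huv, rfl⟩
  constructor
  · intro h
    have := key σ.symm _ _ _ h
    rw [image_image] at this
    have e : (Sym2.map σ.symm ∘ Sym2.map σ) = id := by
      rw [← Sym2.map_comp]; simp
    rw [e] at this
    simpa using this
  · exact key σ F a b

lemma rc_short (F : Finset (Sym2 V)) (a b : V) (hab : a ≠ b) (hF : F.card ≤ 3) (h : rc F a b) :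
    s(a,b) ∈ F ∨ (∃ c, c ≠ a ∧ c ≠ b ∧ s(a,c) ∈ F ∧ s(c,b) ∈ F) ∨
    (∃ c d, c ≠ a ∧ c ≠ b ∧ d ≠ a ∧ d ≠ b ∧ c ≠ d ∧ s(a,c) ∈ F ∧ s(c,d) ∈ F ∧ s(d,b) ∈ F) := by
  obtain ⟨p, hp⟩ := SimpleGraph.Reachable.exists_isPath h
  have hl : p.length ≤ 3 := by
    rw [← p.length_edges, ← List.toFinset_card_of_nodup hp.isTrail.edges_nodup]
    refine (card_le_card ?_).trans hF
    intro e he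
    have := p.edges_subset_edgeSet (List.mem_toFinset.1 he)
    simp at this
    exact this.1
  cases p with
  | nil => exact absurd rfl hab
  | @cons _ c _ h1 p =>
    cases p with
    | nil => left; simp at h1; exact h1.1
    | @cons _ d _ h2 p =>
      cases p with
      | nil =>
        right; left
        simp at h1 h2
        exact ⟨c, fun k => h1.2 k.symm, h2.2, h1.1, h2.1⟩
      | @cons _ x _ h3 p =>
        cases p with
        | nil =>
          right; right
          simp at h1 h2 h3 hp
          refine ⟨c, d, ?_⟩
          refine ⟨fun k => h1.2 k.symm, ?_, ?_, h3.2, h2.2, h1.1, h2.1, h3.1⟩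
          · tauto
          · intro k; subst k; tauto
        | cons h4 p => simp at hl; omega

lemma rc_short2 (F : Finset (Sym2 V)) (a b : V) (hab : a ≠ b) (hF : F.card ≤ 2) (h : rc F a b) :
    s(a,b) ∈ F ∨ (∃ c, c ≠ a ∧ c ≠ b ∧ s(a,c) ∈ F ∧ s(c,b) ∈ F) := by
  rcases rc_short F a b hab (by omega) h with h | h | ⟨c, d, h1, h2, h3, h4, h5, h6, h7, h8⟩
  · exact Or.inl h
  · exact Or.inr h
  · exfalso
    have : ({s(a,c), s(c,d), s(d,b)} : Finset (Sym2 V)).card = 3 := by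
      rw [card_eq_three]
      refine ⟨_, _, _, ?_, ?_, ?_, rfl⟩ <;> simp [Sym2.eq_iff] <;> grind
    have h9 : ({s(a,c), s(c,d), s(d,b)} : Finset (Sym2 V)) ⊆ F := by
      intro e; simp; rintro (rfl | rfl | rfl) <;> assumption
    have := card_le_card h9
    omega

lemma card_sup (E S : Finset (Sym2 V)) (j : ℕ) (hS : S ⊆ E) (hj : S.card ≤ j) :
    ((powersetCard j E).filter (fun F => S ⊆ F)).card = (E.card - S.card).choose (j - S.card) := by
  rw [← card_sdiff_of_subset hS, ← card_powersetCard]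
  refine card_nbij' (fun F => F \ S) (fun F => F ∪ S) ?_ ?_ ?_ ?_
  · intro F hF
    simp only [mem_coe, mem_powersetCard, mem_filter] at hF ⊢
    exact ⟨sdiff_subset_sdiff hF.1.1 le_rfl, by rw [card_sdiff_of_subset hF.2, hF.1.2]⟩
  · intro F hF
    simp only [mem_coe, mem_powersetCard, mem_filter] at hF ⊢
    refine ⟨⟨union_subset (hF.1.trans sdiff_subset) hS, ?_⟩, subset_union_right⟩
    rw [card_union_of_disjoint, hF.2]; omega
    exact disjoint_of_subset_left hF.1 sdiff_disjoint
  · intro F hF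
    simp only [mem_coe, mem_filter] at hF
    exact sdiff_union_of_subset hF.2
  · intro F hF
    simp only [mem_coe, mem_powersetCard] at hF
    refine union_sdiff_cancel_right (disjoint_of_subset_left hF.1 sdiff_disjoint)

end
end TL
end
end

section
open Finset
open scoped Classical
noncomputable section
namespace TL

section
variable {V : Type} [DecidableEq V] [Fintype V]

def cod (D : SimpleGraph V) (a b : V) : Finset V := univ.filter (fun c => D.Adj a c ∧ D.Adj c b)
def pth (D : SimpleGraph V) (a b : V) : Finset (V × V) :=
  univ.filter (fun x => (x.1 ≠ b ∧ x.2 ≠ a) ∧ D.Adj a x.1 ∧ D.Adj x.1 x.2 ∧ D.Adj x.2 b)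

lemma cod_AA (D : SimpleGraph V) (a b : V) : ((cod D a b).card : ℤ) = ∑ c, AA D a c * AA D c b := by
  rw [cod, card_filter]
  push_cast
  refine sum_congr rfl fun c _ => ?_
  simp only [AA]
  split_ifs <;> simp_all

def nr (F : Finset (Sym2 V)) (a b : V) : Prop := s(a,b) ∈ F ∨ ∃ c, s(a,c) ∈ F ∧ s(c,b) ∈ F

lemma near_card (D : SimpleGraph V) (E : Finset (Sym2 V)) (hE : ∀ u v, s(u,v) ∈ E ↔ D.Adj u v)
    (a b : V) (hab : a ≠ b) (j : ℕ) (hj : 2 ≤ j) (hj3 : j ≤ 3) :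
    ((powersetCard j E).filter (fun F => nr F a b)).card =
      (if D.Adj a b then (E.card - 1).choose (j - 1) else 0) +
      (cod D a b).card * ((E.erase s(a,b)).card - 2).choose (j - 2) := by
  have e1 : (powersetCard j E).filter (fun F => nr F a b) =
      (powersetCard j E).filter (fun F => {s(a,b)} ⊆ F) ∪
      (cod D a b).biUnion (fun c => (powersetCard j (E.erase s(a,b))).filter (fun F => {s(a,c), s(c,b)} ⊆ F)) := by
    ext F
    simp only [mem_filter, mem_union, mem_biUnion, mem_powersetCard, singleton_subset_iff, cod, mem_univ,
      true_and, subset_erase, insert_subset_iff]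
    constructor
    · rintro ⟨⟨h1, h2⟩, h⟩
      by_cases h3 : s(a,b) ∈ F
      · exact Or.inl ⟨⟨h1, h2⟩, h3⟩
      · rcases h with h | ⟨c, h4, h5⟩
        · exact absurd h h3
        · exact Or.inr ⟨c, ⟨(hE _ _).1 (h1 h4), (hE _ _).1 (h1 h5)⟩, ⟨⟨h1, h3⟩, h2⟩, h4, h5⟩
    · rintro (⟨h1, h2⟩ | ⟨c, h1, ⟨⟨h2, h3⟩, h4⟩, h5, h6⟩)
      · exact ⟨h1, Or.inl h2⟩
      · exact ⟨⟨h2, h4⟩, Or.inr ⟨c, h5, h6⟩⟩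
  rw [e1, card_union_of_disjoint, card_biUnion]
  · congr 1
    · split_ifs with h
      · rw [card_sup]
        · simp
        · simpa [hE] using h
        · simp; omega
      · rw [card_eq_zero, filter_eq_empty_iff]
        intro F hF h'
        rw [mem_powersetCard] at hF
        exact h ((hE _ _).1 (hF.1 (h' (by simp))))
    · rw [sum_congr rfl, sum_const, smul_eq_mul]
      intro c hc
      simp only [cod, mem_filter, mem_univ, true_and] at hc
      have h2 : ({s(a,c), s(c,b)} : Finset (Sym2 V)).card = 2 := by
        rw [card_pair]; simp [Sym2.eq_iff]; grind
      rw [card_sup, h2]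
      · have := hc.1.ne
        have := hc.2.ne
        simp only [insert_subset_iff, singleton_subset_iff, mem_erase, hE, hc.1, hc.2, and_true]
        constructor <;> simp [Sym2.eq_iff] <;> grind
      · omega
  · intro c hc d hd hcd
    rw [Function.onFun, disjoint_left]
    intro F hF hF'
    simp only [mem_filter, mem_powersetCard, insert_subset_iff, singleton_subset_iff, cod, mem_univ, true_and,
      mem_coe] at hF hF' hc hd
    have h4 : ({s(a,c), s(c,b), s(a,d), s(d,b)} : Finset (Sym2 V)).card = 4 := by
      have := hc.1.ne
      have := hc.2.ne
      have := hd.1.ne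
      have := hd.2.ne
      rw [card_insert_of_notMem, card_eq_three.2]
      · refine ⟨_, _, _, ?_, ?_, ?_, rfl⟩ <;> simp [Sym2.eq_iff] <;> grind
      · simp [Sym2.eq_iff]; grind
    have h5 : ({s(a,c), s(c,b), s(a,d), s(d,b)} : Finset (Sym2 V)) ⊆ F := by
      intro e; simp; rintro (rfl | rfl | rfl | rfl) <;> tauto
    have := card_le_card h5
    omega
  · rw [disjoint_left]
    intro F hF hF'
    simp only [mem_filter, mem_biUnion, mem_powersetCard, singleton_subset_iff, subset_erase] at hF hF'
    obtain ⟨c, _, h, _⟩ := hF'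
    exact h.1.2 hF.2

lemma nr_rc (F : Finset (Sym2 V)) (a b : V) (h : nr F a b) : rc F a b := by
  rcases h with h | ⟨c, h1, h2⟩
  · exact rc_adj _ _ _ h
  · exact rc_trans (rc_adj _ _ _ h1) (rc_adj _ _ _ h2)

lemma cnt2 (D : SimpleGraph V) (E : Finset (Sym2 V)) (hE : ∀ u v, s(u,v) ∈ E ↔ D.Adj u v)
    (a b : V) (hab : a ≠ b) : (((powersetCard 2 E).filter (fun F => rc F a b)).card : ℤ) =
      AA D a b * (E.card - 1) + ∑ c, AA D a c * AA D c b := by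
  have : (powersetCard 2 E).filter (fun F => rc F a b) = (powersetCard 2 E).filter (fun F => nr F a b) := by
    refine filter_congr fun F hF => ⟨fun h => ?_, nr_rc F a b⟩
    rw [mem_powersetCard] at hF
    rcases rc_short2 F a b hab hF.2.le h with h | ⟨c, _, _, h⟩
    · exact Or.inl h
    · exact Or.inr ⟨c, h⟩
  rw [this, near_card D E hE a b hab 2 le_rfl (by omega), ← cod_AA]
  by_cases h : D.Adj a b
  · have : 0 < E.card := card_pos.2 ⟨_, (hE _ _).2 h⟩
    simp [AA, h]
    omega
  · simp [AA, h]

lemma cnt3 (D : SimpleGraph V) (E : Finset (Sym2 V)) (hE : ∀ u v, s(u,v) ∈ E ↔ D.Adj u v)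
    (a b : V) (hab : a ≠ b) : (((powersetCard 3 E).filter (fun F => rc F a b)).card : ℤ) =
      AA D a b * ((E.card - 1).choose 2 : ℕ) + (∑ c, AA D a c * AA D c b) * (E.card - 2 - AA D a b)
      + (pth D a b).card := by
  have e1 : (powersetCard 3 E).filter (fun F => rc F a b) = (powersetCard 3 E).filter (fun F => nr F a b) ∪
      (pth D a b).image (fun x => {s(a,x.1), s(x.1,x.2), s(x.2,b)}) := by
    ext F
    simp only [mem_filter, mem_union, mem_image, mem_powersetCard]
    constructor
    · rintro ⟨h, h'⟩
      rcases rc_short F a b hab h.2.le h' with h' | ⟨c, _, _, h'⟩ | ⟨c, d, h1, h2, h3, h4, h5, h6, h7, h8⟩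
      · exact Or.inl ⟨h, Or.inl h'⟩
      · exact Or.inl ⟨h, Or.inr ⟨c, h'⟩⟩
      · right
        refine ⟨(c, d), ?_, ?_⟩
        · simp only [pth, mem_filter, mem_univ, true_and]
          exact ⟨⟨h2, h3⟩, (hE _ _).1 (h.1 h6), (hE _ _).1 (h.1 h7), (hE _ _).1 (h.1 h8)⟩
        · apply eq_of_subset_of_card_le
          · intro e; simp; rintro (rfl | rfl | rfl) <;> assumption
          · rw [h.2]
            apply le_of_eq; symm
            rw [card_eq_three]
            refine ⟨_, _, _, ?_, ?_, ?_, rfl⟩ <;> simp [Sym2.eq_iff] <;> grind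
    · rintro (⟨h, h'⟩ | ⟨⟨c, d⟩, h, rfl⟩)
      · exact ⟨h, nr_rc _ _ _ h'⟩
      · simp only [pth, mem_filter, mem_univ, true_and] at h
        obtain ⟨⟨h1, h2⟩, h3, h4, h5⟩ := h
        refine ⟨⟨?_, ?_⟩, ?_⟩
        · intro e; simp; rintro (rfl | rfl | rfl) <;> simpa [hE]
        · have := h3.ne
          have := h4.ne
          have := h5.ne
          rw [card_eq_three]
          refine ⟨_, _, _, ?_, ?_, ?_, rfl⟩ <;> simp [Sym2.eq_iff] <;> grind
        · exact rc_trans (rc_adj _ _ c (by simp)) (rc_trans (rc_adj _ _ d (by simp)) (rc_adj _ _ _ (by simp)))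
  rw [e1, card_union_of_disjoint, card_image_of_injOn, near_card D E hE a b hab 3 (by omega) le_rfl]
  · push_cast
    congr 1
    rw [← cod_AA]
    congr 1
    · by_cases h : D.Adj a b <;> simp [AA, h]
    · by_cases hc : (cod D a b) = ∅
      · simp [hc]
      · congr 1
        obtain ⟨c, hc⟩ := nonempty_iff_ne_empty.2 hc
        simp only [cod, mem_filter, mem_univ, true_and] at hc
        have h2 : ({s(a,c), s(c,b)} : Finset (Sym2 V)).card = 2 := by
          rw [card_pair]; simp [Sym2.eq_iff]; grind
        have h3 : ({s(a,c), s(c,b)} : Finset (Sym2 V)) ⊆ E.erase s(a,b) := by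
          have := hc.1.ne
          have := hc.2.ne
          simp only [insert_subset_iff, singleton_subset_iff, mem_erase, hE, hc.1, hc.2, and_true]
          constructor <;> simp [Sym2.eq_iff] <;> grind
        have h4 := card_le_card h3
        simp only [Nat.reduceSub, Nat.choose_one_right]
        by_cases h : D.Adj a b
        · rw [card_erase_of_mem ((hE _ _).2 h)] at h4 ⊢
          simp [AA, h]
          omega
        · rw [erase_eq_of_notMem (by rwa [hE])] at h4 ⊢
          simp [AA, h]
          omega
  · rintro ⟨c, d⟩ h ⟨c', d'⟩ h' heq
    simp only [pth, mem_filter, mem_univ, true_and, mem_coe] at h h'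
    obtain ⟨⟨h1, h2⟩, h3, h4, h5⟩ := h
    obtain ⟨⟨h1', h2'⟩, h3', h4', h5'⟩ := h'
    have := h3.ne
    have := h4.ne
    have := h5.ne
    have := h3'.ne
    have := h4'.ne
    have := h5'.ne
    simp only at heq
    have m1 : s(a,c) ∈ ({s(a,c'), s(c',d'), s(d',b)} : Finset (Sym2 V)) := heq ▸ (by simp)
    have m2 : s(d,b) ∈ ({s(a,c'), s(c',d'), s(d',b)} : Finset (Sym2 V)) := heq ▸ (by simp)
    simp [Sym2.eq_iff] at m1 m2
    rw [Prod.mk.injEq]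
    grind
  · rw [disjoint_left]
    intro F hF hF'
    simp only [mem_filter, mem_powersetCard, mem_image] at hF hF'
    obtain ⟨⟨c, d⟩, h, rfl⟩ := hF'
    simp only [pth, mem_filter, mem_univ, true_and] at h
    obtain ⟨⟨h1, h2⟩, h3, h4, h5⟩ := h
    have := h3.ne
    have := h4.ne
    have := h5.ne
    obtain ⟨_, h | ⟨x, h6, h7⟩⟩ := hF
    · simp [Sym2.eq_iff] at h; grind
    · simp [Sym2.eq_iff] at h6 h7; grind
end
end TL
end
end

section
open Finset
open scoped Classical
noncomputable section
namespace TL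

section
variable {V : Type} [DecidableEq V] [Fintype V]

def RP (F : Finset (Sym2 V)) : ℕ := ((univ : Finset (V × V)).filter (fun x => rc F x.1 x.2)).card

lemma pth_AA (D : SimpleGraph V) (a b : V) : ((pth D a b).card : ℤ) =
    (∑ c, ∑ d, AA D a c * AA D c d * AA D d b) - AA D a b * dg D b - AA D a b * dg D a + AA D a b := by
  have h1 : ((pth D a b).card : ℤ) = ∑ c, ∑ d, (if c ≠ b ∧ d ≠ a then AA D a c * AA D c d * AA D d b else 0) := by
    rw [pth, card_filter, ← univ_product_univ, sum_product]
    push_cast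
    refine sum_congr rfl fun c _ => sum_congr rfl fun d _ => ?_
    simp only [AA]
    split_ifs <;> simp_all
  have h2 : ∀ c d, (if c ≠ b ∧ d ≠ a then AA D a c * AA D c d * AA D d b else 0) =
      AA D a c * AA D c d * AA D d b - (if c = b then AA D a c * AA D c d * AA D d b else 0)
      - (if d = a then AA D a c * AA D c d * AA D d b else 0)
      + (if c = b then (if d = a then AA D a c * AA D c d * AA D d b else 0) else 0) := by
    intro c d
    by_cases h1 : c = b <;> by_cases h2 : d = a <;> simp [h1, h2]
  have h3 : ∀ c, ∑ d, (if c = b then AA D a c * AA D c d * AA D d b else 0) =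
      if c = b then ∑ d, AA D a c * AA D c d * AA D d b else 0 := by
    intro c; split_ifs <;> simp
  have h4 : ∀ c, ∑ d, (if c = b then (if d = a then AA D a c * AA D c d * AA D d b else 0) else 0) =
      if c = b then ∑ d, (if d = a then AA D a c * AA D c d * AA D d b else 0) else 0 := by
    intro c; split_ifs <;> simp
  rw [h1]
  simp only [h2, sum_add_distrib, sum_sub_distrib, h3, h4]
  simp only [sum_ite_eq', mem_univ, if_true]
  have k1 : ∑ d, AA D a b * AA D b d * AA D d b = AA D a b * dg D b := by
    rw [dg, mul_sum]
    refine sum_congr rfl fun d _ => ?_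
    rw [AA_symm D d b, mul_assoc, AA_sq]
  have k2 : ∑ c, AA D a c * AA D c a * AA D a b = AA D a b * dg D a := by
    rw [dg, mul_sum]
    refine sum_congr rfl fun d _ => ?_
    rw [AA_symm D d a, AA_sq, mul_comm]
  rw [k1, k2, AA_symm D b a, AA_sq, AA_sq]

lemma rho_gen (E : Finset (Sym2 V)) (j : ℕ) (f : V → V → ℤ)
    (hf : ∀ a b, a ≠ b → (((powersetCard j E).filter (fun F => rc F a b)).card : ℤ) = f a b) :
    (∑ F ∈ powersetCard j E, (RP F : ℤ)) = Fintype.card V * (E.card.choose j : ℕ)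
      + ∑ a, ∑ b, f a b - ∑ a, f a a := by
  have h1 : (∑ F ∈ powersetCard j E, (RP F : ℤ)) =
      ∑ a, ∑ b, (((powersetCard j E).filter (fun F => rc F a b)).card : ℤ) := by
    simp only [RP, card_filter]
    push_cast
    rw [sum_comm, ← univ_product_univ, sum_product]
  have h2 : ∀ a b, (((powersetCard j E).filter (fun F => rc F a b)).card : ℤ) =
      f a b + if a = b then (E.card.choose j : ℕ) - f a b else 0 := by
    intro a b
    by_cases h : a = b
    · subst h
      simp [rc_refl]
    · simp [h, hf a b h]
  rw [h1]
  simp only [h2, sum_add_distrib]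
  simp
  ring

lemma sum_cod (D : SimpleGraph V) : ∑ a, ∑ b, ∑ c, AA D a c * AA D c b = sM D := by
  have : ∀ a, ∑ b, ∑ c, AA D a c * AA D c b = ∑ c, AA D a c * dg D c := by
    intro a
    rw [sum_comm]
    refine sum_congr rfl fun c _ => ?_
    rw [← mul_sum]; rfl
  simp only [this]
  exact sAd' D

lemma cod_self (D : SimpleGraph V) (a : V) : ∑ c, AA D a c * AA D c a = dg D a := by
  rw [dg]
  refine sum_congr rfl fun c _ => ?_
  rw [AA_symm D c a, AA_sq]

lemma sum_s2 (D : SimpleGraph V) : ∑ a, ∑ b, AA D a b = s2 D := rfl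

lemma rho2 (D : SimpleGraph V) (E : Finset (Sym2 V)) (hE : ∀ u v, s(u,v) ∈ E ↔ D.Adj u v) :
    (∑ F ∈ powersetCard 2 E, (RP F : ℤ)) = Fintype.card V * (E.card.choose 2 : ℕ)
      + s2 D * (E.card - 1) + sM D - s2 D := by
  rw [rho_gen E 2 _ (cnt2 D E hE)]
  simp only [sum_add_distrib, ← sum_mul, cod_self, AA_self, zero_mul, sum_cod, sum_s2]
  simp only [sum_const_zero]
  rw [← s2]; ring

lemma rho3 (D : SimpleGraph V) (E : Finset (Sym2 V)) (hE : ∀ u v, s(u,v) ∈ E ↔ D.Adj u v) :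
    (∑ F ∈ powersetCard 3 E, (RP F : ℤ)) = Fintype.card V * (E.card.choose 3 : ℕ)
      + s2 D * ((E.card - 1).choose 2 : ℕ) + (sM D - s2 D) * (E.card - 2) - 2 * sM D + s2 D
      + (sP D - 2 * sT D) := by
  rw [rho_gen E 3 _ (cnt3 D E hE)]
  have t1 : ∑ a, ∑ b, ∑ c, ∑ d, AA D a c * AA D c d * AA D d b = sP D := by
    rw [sP]
    have : ∀ a b, ∑ c, ∑ d, AA D a c * AA D c d * AA D d b = ∑ c, AA D a c * ∑ d, AA D c d * AA D d b := by
      intro a b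
      refine sum_congr rfl fun c _ => ?_
      rw [mul_sum]
      exact sum_congr rfl fun d _ => by ring
    simp only [this]
    have h2 : ∀ a, ∑ b, ∑ c, AA D a c * ∑ d, AA D c d * AA D d b = ∑ c, AA D a c * ∑ d, AA D c d * dg D d := by
      intro a
      rw [sum_comm]
      refine sum_congr rfl fun c _ => ?_
      rw [← mul_sum, sum_comm]
      congr 1
      refine sum_congr rfl fun d _ => ?_
      rw [← mul_sum]; rfl
    simp only [h2]
    rw [sum_comm]
    refine sum_congr rfl fun c _ => ?_
    rw [← sum_mul, mul_sum]
    have : ∑ a, AA D a c = dg D c := by rw [dg]; exact sum_congr rfl fun a _ => AA_symm D a c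
    rw [this]
    exact sum_congr rfl fun d _ => by ring
  have t2 : ∑ a, ∑ c, ∑ d, AA D a c * AA D c d * AA D d a = sT D := by
    rw [sT]
    refine sum_congr rfl fun a _ => sum_congr rfl fun c _ => sum_congr rfl fun d _ => ?_
    rw [AA_symm D d a]
  have t3 : ∑ a, ∑ b, (∑ c, AA D a c * AA D c b) * AA D a b = sT D := by
    rw [sT]
    refine sum_congr rfl fun a _ => ?_
    simp only [sum_mul]
    rw [sum_comm]
  have t4 : ∑ x, (∑ i, AA D x i) * dg D x = sM D := by
    rw [sM]
    refine sum_congr rfl fun a _ => ?_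
    rw [← dg]; ring
  simp only [pth_AA, mul_sub, sum_add_distrib, sum_sub_distrib, ← sum_mul, cod_self, AA_self, zero_mul, sum_cod,
    sum_s2, mul_zero, sum_const_zero, t1, t2, t3, t4, sAd, sAd']
  rw [← s2]; ring
end
end TL
end
end

section
open Finset
open scoped Classical
noncomputable section
namespace TL

section
variable {V : Type} [DecidableEq V] [Fintype V]

lemma dec_union (C E : Finset (Sym2 V)) (hCE : Disjoint C E) (i : ℕ) (P : Finset (Sym2 V) → Prop) :
    ((powersetCard i (C ∪ E)).filter P).card = ∑ j ∈ range (i+1), ∑ F ∈ powersetCard j E,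
      ((powersetCard (i - j) C).filter (fun A => P (A ∪ F))).card := by
  have h : ∀ j, ∑ F ∈ powersetCard j E, ((powersetCard (i - j) C).filter (fun A => P (A ∪ F))).card =
      ((powersetCard j E).sigma (fun F => (powersetCard (i - j) C).filter (fun A => P (A ∪ F)))).card := by
    intro j; rw [card_sigma]
  simp only [h]
  rw [← card_sigma]
  refine card_nbij' (fun F => ⟨(F ∩ E).card, F ∩ E, F ∩ C⟩) (fun x => x.2.2 ∪ x.2.1) ?_ ?_ ?_ ?_
  · intro F hF
    simp only [mem_coe, mem_filter, mem_powersetCard, mem_sigma, mem_range] at hF ⊢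
    have e1 : F ∩ C ∪ F ∩ E = F := by rw [← inter_union_distrib_left, inter_eq_left.2 hF.1.1]
    have e2 : (F ∩ C).card + (F ∩ E).card = i := by
      rw [← card_union_of_disjoint, e1, hF.1.2]
      exact disjoint_of_subset_left inter_subset_right (disjoint_of_subset_right inter_subset_right hCE)
    refine ⟨by omega, ⟨inter_subset_right, by simp⟩, ⟨inter_subset_right, by omega⟩, ?_⟩
    rw [e1]; exact hF.2
  · rintro ⟨j, F, A⟩ hF
    simp only [mem_coe, mem_filter, mem_powersetCard, mem_sigma, mem_range] at hF ⊢
    obtain ⟨h1, ⟨h2, h3⟩, ⟨h4, h5⟩, h6⟩ := hF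
    refine ⟨⟨union_subset_union h4 h2, ?_⟩, h6⟩
    rw [card_union_of_disjoint (disjoint_of_subset_left h4 (disjoint_of_subset_right h2 hCE))]
    omega
  · intro F hF
    simp only [mem_coe, mem_filter, mem_powersetCard] at hF
    simp only
    rw [← inter_union_distrib_left, inter_eq_left.2 hF.1.1]
  · rintro ⟨j, F, A⟩ hF
    simp only [mem_coe, mem_filter, mem_powersetCard, mem_sigma, mem_range] at hF
    obtain ⟨h1, ⟨h2, h3⟩, ⟨h4, h5⟩, h6⟩ := hF
    have e1 : (A ∪ F) ∩ E = F := by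
      rw [union_inter_distrib_right, inter_eq_left.2 h2,
        disjoint_iff_inter_eq_empty.1 (disjoint_of_subset_left h4 hCE), empty_union]
    have e2 : (A ∪ F) ∩ C = A := by
      rw [union_inter_distrib_right, inter_eq_left.2 h4,
        disjoint_iff_inter_eq_empty.1 (disjoint_of_subset_left h2 hCE.symm), union_empty]
    simp only [e1, e2, h3]

def KK (s t : V) : Finset (Sym2 V) := univ.filter (fun e => ¬ e.IsDiag ∧ s ∉ e ∧ t ∉ e)
def CC (s t : V) : Finset (Sym2 V) := univ.filter (fun e => ¬ e.IsDiag ∧ (s ∈ e ∨ t ∈ e))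
def rr (s t : V) (k : ℕ) (F : Finset (Sym2 V)) : ℕ :=
  ((powersetCard k (CC s t)).filter (fun A => rc (A ∪ F) s t)).card

lemma CC_inv (s t : V) (σ : Equiv.Perm V) (hs : σ s = s) (ht : σ t = t) (e : Sym2 V) :
    Sym2.map σ e ∈ CC s t ↔ e ∈ CC s t := by
  induction e with
  | _ a b =>
    simp only [CC, mem_filter, mem_univ, true_and, Sym2.map_mk, Sym2.mk_isDiag_iff, Sym2.mem_iff, σ.injective.eq_iff]
    have h1 : ∀ x, s = σ x ↔ s = x := fun x => by conv_lhs => rw [← hs, σ.injective.eq_iff]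
    have h2 : ∀ x, t = σ x ↔ t = x := fun x => by conv_lhs => rw [← ht, σ.injective.eq_iff]
    simp [h1, h2]

lemma rr_inv (s t : V) (k : ℕ) (σ : Equiv.Perm V) (hs : σ s = s) (ht : σ t = t) (F : Finset (Sym2 V)) :
    rr s t k (F.image (Sym2.map σ)) = rr s t k F := by
  symm
  have hinj : Function.Injective (Sym2.map σ) := Sym2.map.injective σ.injective
  refine card_nbij (fun A => A.image (Sym2.map σ)) ?_ ?_ ?_
  · intro A hA
    simp only [mem_coe, mem_filter, mem_powersetCard] at hA ⊢
    refine ⟨⟨?_, ?_⟩, ?_⟩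
    · intro e he
      obtain ⟨e', he', rfl⟩ := mem_image.1 he
      rw [CC_inv s t σ hs ht]; exact hA.1.1 he'
    · rw [card_image_of_injective _ hinj, hA.1.2]
    · rw [← image_union]
      have := (rc_map σ (A ∪ F) s t).2 hA.2
      rwa [hs, ht] at this
  · intro A _ B _ h
    exact image_injective hinj h
  · intro B hB
    simp only [mem_coe, mem_filter, mem_powersetCard] at hB
    have e : (Sym2.map σ ∘ Sym2.map σ.symm) = id := by rw [← Sym2.map_comp]; simp
    have e1 : (B.image (Sym2.map σ.symm)).image (Sym2.map σ) = B := by rw [image_image, e, image_id]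
    refine ⟨B.image (Sym2.map σ.symm), ?_, e1⟩
    simp only [mem_coe, mem_filter, mem_powersetCard]
    refine ⟨⟨?_, ?_⟩, ?_⟩
    · intro x hx
      rw [← CC_inv s t σ hs ht]
      exact hB.1.1 (by rw [← e1]; exact mem_image_of_mem _ hx)
    · rw [card_image_of_injective _ (Sym2.map.injective σ.symm.injective), hB.1.2]
    · have := hB.2
      rw [← e1, ← image_union] at this
      rw [← rc_map σ, hs, ht]
      exact this

lemma no_rc (F : Finset (Sym2 V)) (s t : V) (hst : s ≠ t) (h : ∀ e ∈ F, s ∉ e) : ¬ rc F s t := by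
  intro h'
  have := rc_closed F s t (fun v => v = s) (by
    rintro u v huv rfl
    exact absurd (by simp) (h _ huv)) h' rfl
  exact hst this.symm

lemma no_rc' (F : Finset (Sym2 V)) (s t : V) (hst : s ≠ t) (h : ∀ e ∈ F, t ∉ e) : ¬ rc F s t :=
  fun h' => no_rc F t s hst.symm h (rc_symm h')

lemma KK_s {s t : V} {F : Finset (Sym2 V)} (hF : F ⊆ KK s t) : ∀ e ∈ F, s ∉ e := fun e he => by
  have := hF he; simp [KK] at this; exact this.2.1
lemma KK_t {s t : V} {F : Finset (Sym2 V)} (hF : F ⊆ KK s t) : ∀ e ∈ F, t ∉ e := fun e he => by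
  have := hF he; simp [KK] at this; exact this.2.2

lemma need_st {s t : V} (hst : s ≠ t) {F A : Finset (Sym2 V)} (hF : F ⊆ KK s t) (h : rc (A ∪ F) s t) :
    (∃ e ∈ A, s ∈ e) ∧ (∃ e ∈ A, t ∈ e) := by
  constructor
  · by_contra hc
    push Not at hc
    exact no_rc _ s t hst (fun e he => by
      rcases mem_union.1 he with h | h
      · exact hc e h
      · exact KK_s hF e h) h
  · by_contra hc
    push Not at hc
    exact no_rc' _ s t hst (fun e he => by
      rcases mem_union.1 he with h | h
      · exact hc e h
      · exact KK_t hF e h) h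

lemma rr0 {s t : V} (hst : s ≠ t) {F : Finset (Sym2 V)} (hF : F ⊆ KK s t) : rr s t 0 F = 0 := by
  rw [rr, card_eq_zero, filter_eq_empty_iff]
  intro A hA h
  obtain ⟨⟨e, he, _⟩, _⟩ := need_st hst hF h
  simp at hA
  subst hA
  simp at he

lemma st_mem {s t : V} (hst : s ≠ t) : s(s,t) ∈ CC s t := by simp [CC, hst]

lemma rr1 {s t : V} (hst : s ≠ t) {F : Finset (Sym2 V)} (hF : F ⊆ KK s t) : rr s t 1 F = 1 := by
  rw [rr, card_eq_one]
  refine ⟨{s(s,t)}, ?_⟩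
  ext A
  simp only [mem_filter, mem_powersetCard, mem_singleton]
  constructor
  · rintro ⟨⟨h1, h2⟩, h⟩
    obtain ⟨⟨e, he, hs⟩, ⟨f, hf, ht⟩⟩ := need_st hst hF h
    obtain ⟨x, rfl⟩ := card_eq_one.1 h2
    simp only [mem_singleton] at he hf
    subst he; subst hf
    rw [(Sym2.mem_and_mem_iff hst).1 ⟨hs, ht⟩]
  · rintro rfl
    exact ⟨⟨by simpa using st_mem hst, by simp⟩, rc_adj _ _ _ (by simp)⟩

lemma rr2 {s t : V} (hst : s ≠ t) {F : Finset (Sym2 V)} (hF : F ⊆ KK s t) :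
    rr s t 2 F + 2 = ((CC s t).card - 1) + RP F := by
  let P : Finset (V × V) := univ.filter (fun x => ((x.1 ≠ s ∧ x.1 ≠ t) ∧ (x.2 ≠ s ∧ x.2 ≠ t)) ∧ rc F x.1 x.2)
  have hP : RP F = P.card + 2 := by
    have : (univ : Finset (V × V)).filter (fun x => rc F x.1 x.2) = P ∪ {(s,s), (t,t)} := by
      ext ⟨a, b⟩
      simp only [P, mem_filter, mem_univ, true_and, mem_union, mem_insert, mem_singleton, Prod.mk.injEq]
      constructor
      · intro h
        have k1 : ∀ a b, rc F a b → (a = s → b = s) ∧ (a = t → b = t) := by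
          intro a b h
          refine ⟨fun k => ?_, fun k => ?_⟩
          · by_contra hc
            subst k
            exact no_rc F _ _ (Ne.symm hc) (KK_s hF) h
          · by_contra hc
            subst k
            exact no_rc F _ _ (Ne.symm hc) (KK_t hF) h
        have := k1 a b h
        have := k1 b a (rc_symm h)
        tauto
      · rintro (h | ⟨rfl, rfl⟩ | ⟨rfl, rfl⟩)
        · exact h.2
        · exact rc_refl _ _
        · exact rc_refl _ _
    rw [RP, this, card_union_of_disjoint, card_pair]
    · simp [hst]
    · simp [P]
  have e1 : (powersetCard 2 (CC s t)).filter (fun A => rc (A ∪ F) s t) =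
      (powersetCard 2 (CC s t)).filter (fun A => {s(s,t)} ⊆ A) ∪
      P.image (fun x => {s(s,x.1), s(t,x.2)}) := by
    ext A
    simp only [mem_filter, mem_powersetCard, mem_union, mem_image, singleton_subset_iff]
    constructor
    · rintro ⟨⟨h1, h2⟩, h⟩
      by_cases hA : s(s,t) ∈ A
      · exact Or.inl ⟨⟨h1, h2⟩, hA⟩
      right
      obtain ⟨⟨e, he, hs⟩, ⟨f, hf, ht⟩⟩ := need_st hst hF h
      obtain ⟨a, rfl⟩ := Sym2.mem_iff_exists.1 hs
      obtain ⟨b, rfl⟩ := Sym2.mem_iff_exists.1 ht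
      have ha : a ≠ t := by rintro rfl; exact hA he
      have hb : b ≠ s := by rintro rfl; exact hA (by rwa [Sym2.eq_swap])
      have ha' : a ≠ s := by
        rintro rfl; have := h1 he; simp [CC] at this
      have hb' : b ≠ t := by
        rintro rfl; have := h1 hf; simp [CC] at this
      have hAe : {s(s,a), s(t,b)} = A := by
        apply eq_of_subset_of_card_le
        · intro e; simp; rintro (rfl | rfl) <;> assumption
        · rw [h2, card_pair]
          simp [Sym2.eq_iff]; grind
      refine ⟨(a, b), ?_, hAe⟩
      simp only [P, mem_filter, mem_univ, true_and]
      refine ⟨⟨⟨ha', ha⟩, ⟨hb, hb'⟩⟩, ?_⟩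
      by_contra hc
      have key := rc_closed (A ∪ F) s t (fun v => v = s ∨ rc F a v) (by
        intro u v huv hu
        rcases mem_union.1 huv with k | k
        · rw [← hAe] at k
          simp only [mem_insert, mem_singleton, Sym2.eq_iff] at k
          rcases k with (⟨rfl, rfl⟩ | ⟨rfl, rfl⟩) | (⟨rfl, rfl⟩ | ⟨rfl, rfl⟩)
          · exact Or.inr (rc_refl _ _)
          · exact Or.inl rfl
          · rcases hu with hu | hu
            · exact absurd hu.symm hst
            · exact absurd hu (no_rc' F _ _ ha (KK_t hF))
          · rcases hu with hu | hu
            · exact absurd hu hb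
            · exact absurd hu hc
        · rcases hu with hu | hu
          · subst hu
            exact absurd (by simp) (KK_s hF _ k)
          · exact Or.inr (rc_trans hu (rc_adj _ _ _ k))) h (Or.inl rfl)
      rcases key with k | k
      · exact hst k.symm
      · exact no_rc' F _ _ ha (KK_t hF) k
    · rintro (⟨h, h'⟩ | ⟨⟨a, b⟩, h, rfl⟩)
      · exact ⟨h, rc_adj _ _ _ (mem_union_left _ h')⟩
      · simp only [P, mem_filter, mem_univ, true_and] at h
        obtain ⟨⟨⟨h1, h2⟩, ⟨h3, h4⟩⟩, h5⟩ := h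
        refine ⟨⟨?_, ?_⟩, ?_⟩
        · intro e; simp only [mem_insert, mem_singleton]
          rintro (rfl | rfl)
          · simp [CC, Ne.symm h1]
          · simp [CC, Ne.symm h4]
        · rw [card_pair]; simp [Sym2.eq_iff]; grind
        · refine rc_trans (rc_adj _ _ a (by simp)) (rc_trans (rc_mono subset_union_right h5) (rc_symm (rc_adj _ _ _ (by simp))))
  rw [rr, e1, card_union_of_disjoint, card_image_of_injOn, card_sup, hP]
  · simp; omega
  · simpa using st_mem hst
  · simp
  · rintro ⟨a, b⟩ h ⟨c, d⟩ h' heq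
    simp only [P, mem_filter, mem_univ, true_and, mem_coe] at h h'
    simp only at heq
    have m1 : s(s,a) ∈ ({s(s,c), s(t,d)} : Finset (Sym2 V)) := heq ▸ (by simp)
    have m2 : s(t,b) ∈ ({s(s,c), s(t,d)} : Finset (Sym2 V)) := heq ▸ (by simp)
    simp [Sym2.eq_iff] at m1 m2
    rw [Prod.mk.injEq]
    grind
  · rw [disjoint_left]
    intro A hA hA'
    simp only [mem_filter, singleton_subset_iff, mem_image] at hA hA'
    obtain ⟨⟨a, b⟩, h, rfl⟩ := hA'
    simp only [P, mem_filter, mem_univ, true_and] at h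
    have := hA.2
    simp [Sym2.eq_iff] at this
    grind
end
end TL
end
end

section
open Finset
open scoped Classical
noncomputable section
namespace TL

section
variable {V : Type} [DecidableEq V] [Fintype V]

lemma perm_list (l l' : List V) (h : l.Nodup) (h' : l'.Nodup) (hl : l.length = l'.length) :
    ∃ σ : Equiv.Perm V, l.map σ = l' := by
  obtain ⟨σ, hσ⟩ := Equiv.Perm.exists_extending_pair l.get (fun i => l'.get (Fin.cast hl i))
    (List.nodup_iff_injective_get.1 h) (fun i j hij => by
      have := List.nodup_iff_injective_get.1 h' hij
      exact Fin.cast_injective _ this)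
  refine ⟨σ, ?_⟩
  apply List.ext_getElem
  · simpa using hl
  · intro i h1 h2
    have := hσ ⟨i, by simpa using h1⟩
    simpa using this

def inc (F : Finset (Sym2 V)) : ℤ := ((univ : Finset V).filter (fun v => ∀ e ∈ F, v ∈ e)).card

lemma pair_shape (s t : V) (F : Finset (Sym2 V)) (hF : F ∈ powersetCard 2 (KK s t)) :
    (∃ a b c, (a ≠ s ∧ a ≠ t ∧ b ≠ s ∧ b ≠ t ∧ c ≠ s ∧ c ≠ t ∧ a ≠ b ∧ a ≠ c ∧ b ≠ c) ∧
      F = {s(a,b), s(a,c)} ∧ inc F = 1) ∨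
    (∃ a b c d, (a ≠ s ∧ a ≠ t ∧ b ≠ s ∧ b ≠ t ∧ c ≠ s ∧ c ≠ t ∧ d ≠ s ∧ d ≠ t ∧ a ≠ b ∧ a ≠ c ∧ b ≠ c ∧
      a ≠ d ∧ b ≠ d ∧ c ≠ d) ∧ F = {s(a,b), s(c,d)} ∧ inc F = 0) := by
  rw [mem_powersetCard] at hF
  obtain ⟨hF, h2⟩ := hF
  obtain ⟨e, f, hef, rfl⟩ := card_eq_two.1 h2
  have he : e ∈ KK s t := hF (by simp)
  have hf : f ∈ KK s t := hF (by simp)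
  have key : ∀ a b c : V, (a ≠ s ∧ a ≠ t ∧ b ≠ s ∧ b ≠ t ∧ c ≠ s ∧ c ≠ t ∧ a ≠ b ∧ a ≠ c ∧ b ≠ c) →
      inc {s(a,b), s(a,c)} = 1 := by
    intro a b c h
    rw [inc]
    have : (univ : Finset V).filter (fun v => ∀ e ∈ ({s(a,b), s(a,c)} : Finset (Sym2 V)), v ∈ e) = {a} := by
      ext v
      simp only [mem_filter, mem_univ, true_and, mem_insert, mem_singleton, forall_eq_or_imp, forall_eq, Sym2.mem_iff]
      grind
    rw [this]; simp
  induction e with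
  | _ a b =>
  induction f with
  | _ c d =>
  simp only [KK, mem_filter, mem_univ, true_and, Sym2.mk_isDiag_iff, Sym2.mem_iff, not_or] at he hf
  have hne : ¬ (a = c ∧ b = d ∨ a = d ∧ b = c) := by rw [← Sym2.eq_iff]; exact hef
  by_cases h1 : a = c
  · subst h1
    have : (a ≠ s ∧ a ≠ t ∧ b ≠ s ∧ b ≠ t ∧ d ≠ s ∧ d ≠ t ∧ a ≠ b ∧ a ≠ d ∧ b ≠ d) := by grind
    exact Or.inl ⟨a, b, d, this, rfl, key _ _ _ this⟩
  by_cases h2 : a = d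
  · subst h2
    have : (a ≠ s ∧ a ≠ t ∧ b ≠ s ∧ b ≠ t ∧ c ≠ s ∧ c ≠ t ∧ a ≠ b ∧ a ≠ c ∧ b ≠ c) := by grind
    rw [Sym2.eq_swap (a := c)]
    exact Or.inl ⟨a, b, c, this, rfl, key _ _ _ this⟩
  by_cases h3 : b = c
  · subst h3
    have : (b ≠ s ∧ b ≠ t ∧ a ≠ s ∧ a ≠ t ∧ d ≠ s ∧ d ≠ t ∧ b ≠ a ∧ b ≠ d ∧ a ≠ d) := by grind
    rw [Sym2.eq_swap (a := a)]
    exact Or.inl ⟨b, a, d, this, rfl, key _ _ _ this⟩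
  by_cases h4 : b = d
  · subst h4
    have : (b ≠ s ∧ b ≠ t ∧ a ≠ s ∧ a ≠ t ∧ c ≠ s ∧ c ≠ t ∧ b ≠ a ∧ b ≠ c ∧ a ≠ c) := by grind
    rw [Sym2.eq_swap (a := a), Sym2.eq_swap (a := c)]
    exact Or.inl ⟨b, a, c, this, rfl, key _ _ _ this⟩
  · right
    refine ⟨a, b, c, d, by grind, rfl, ?_⟩
    rw [inc]
    norm_cast
    rw [card_eq_zero, filter_eq_empty_iff]
    intro v _ hv
    have k1 := hv s(a,b) (by simp)
    have k2 := hv s(c,d) (by simp)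
    simp only [Sym2.mem_iff] at k1 k2
    grind

lemma rr_pair (s t : V) (hst : s ≠ t) (k : ℕ) (F F' : Finset (Sym2 V)) (hF : F ∈ powersetCard 2 (KK s t))
    (hF' : F' ∈ powersetCard 2 (KK s t)) (hi : inc F = inc F') : rr s t k F = rr s t k F' := by
  rcases pair_shape s t F hF with ⟨a, b, c, h, rfl, h1⟩ | ⟨a, b, c, d, h, rfl, h1⟩ <;>
  rcases pair_shape s t F' hF' with ⟨a', b', c', h', rfl, h1'⟩ | ⟨a', b', c', d', h', rfl, h1'⟩
  · obtain ⟨σ, hσ⟩ := perm_list [s, t, a, b, c] [s, t, a', b', c'] (by simp; grind) (by simp; grind) rfl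
    simp at hσ
    rw [← rr_inv s t k σ hσ.1 hσ.2.1]
    simp [image_insert, hσ]
  · rw [h1, h1'] at hi; norm_num at hi
  · rw [h1, h1'] at hi; norm_num at hi
  · obtain ⟨σ, hσ⟩ := perm_list [s, t, a, b, c, d] [s, t, a', b', c', d'] (by simp; grind) (by simp; grind) rfl
    simp at hσ
    rw [← rr_inv s t k σ hσ.1 hσ.2.1]
    simp [image_insert, hσ]

lemma rr_single (s t : V) (hst : s ≠ t) (k : ℕ) (F F' : Finset (Sym2 V)) (hF : F ∈ powersetCard 1 (KK s t))
    (hF' : F' ∈ powersetCard 1 (KK s t)) : rr s t k F = rr s t k F' := by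
  rw [mem_powersetCard] at hF hF'
  obtain ⟨e, rfl⟩ := card_eq_one.1 hF.2
  obtain ⟨f, rfl⟩ := card_eq_one.1 hF'.2
  have he : e ∈ KK s t := hF.1 (by simp)
  have hf : f ∈ KK s t := hF'.1 (by simp)
  induction e with
  | _ a b =>
  induction f with
  | _ c d =>
  simp only [KK, mem_filter, mem_univ, true_and, Sym2.mk_isDiag_iff, Sym2.mem_iff, not_or] at he hf
  obtain ⟨σ, hσ⟩ := perm_list [s, t, a, b] [s, t, c, d] (by simp; grind) (by simp; grind) rfl
  simp at hσ
  rw [← rr_inv s t k σ hσ.1 hσ.2.1]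
  simp [hσ]

lemma sum_two {α : Type} [DecidableEq α] (S1 S2 : Finset α) (f g : α → ℤ)
    (hg : ∀ x ∈ S1 ∪ S2, g x = 0 ∨ g x = 1)
    (hf : ∀ x ∈ S1 ∪ S2, ∀ y ∈ S1 ∪ S2, g x = g y → f x = f y) (hc : S1.card = S2.card)
    (hs : ∑ x ∈ S1, g x = ∑ x ∈ S2, g x) : ∑ x ∈ S1, f x = ∑ x ∈ S2, f x := by
  obtain ⟨u, hu⟩ : ∃ u, ∀ x ∈ S1 ∪ S2, g x = 0 → f x = u := by
    by_cases h : ∃ x ∈ S1 ∪ S2, g x = 0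
    · obtain ⟨x, hx, h⟩ := h
      exact ⟨f x, fun y hy h' => hf y hy x hx (by rw [h, h'])⟩
    · exact ⟨0, fun y hy h' => absurd ⟨y, hy, h'⟩ h⟩
  obtain ⟨w, hw⟩ : ∃ w, ∀ x ∈ S1 ∪ S2, g x = 1 → f x = w := by
    by_cases h : ∃ x ∈ S1 ∪ S2, g x = 1
    · obtain ⟨x, hx, h⟩ := h
      exact ⟨f x, fun y hy h' => hf y hy x hx (by rw [h, h'])⟩
    · exact ⟨0, fun y hy h' => absurd ⟨y, hy, h'⟩ h⟩
  have : ∀ x ∈ S1 ∪ S2, f x = u + (w - u) * g x := by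
    intro x hx
    rcases hg x hx with h | h
    · rw [hu x hx h, h]; ring
    · rw [hw x hx h, h]; ring
  rw [sum_congr rfl (fun x hx => this x (mem_union_left _ hx)),
    sum_congr rfl (fun x hx => this x (mem_union_right _ hx)), sum_add_distrib, sum_add_distrib,
    ← mul_sum, ← mul_sum, hs]
  simp [hc]

lemma sum_inc (D : SimpleGraph V) (E : Finset (Sym2 V)) (hE : ∀ u v, s(u,v) ∈ E ↔ D.Adj u v) :
    2 * ∑ F ∈ powersetCard 2 E, inc F = sM D - s2 D := by
  have h1 : ∑ F ∈ powersetCard 2 E, inc F = ∑ v, ((powersetCard 2 (E.filter (fun e => v ∈ e))).card : ℤ) := by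
    have : ∀ v, powersetCard 2 (E.filter (fun e => v ∈ e)) = (powersetCard 2 E).filter (fun F => ∀ e ∈ F, v ∈ e) := by
      intro v
      ext F
      simp only [mem_powersetCard, mem_filter, subset_iff]
      constructor
      · rintro ⟨h, h'⟩
        exact ⟨⟨fun x hx => (h hx).1, h'⟩, fun x hx => (h hx).2⟩
      · rintro ⟨⟨h, h'⟩, h2⟩
        exact ⟨fun x hx => ⟨h hx, h2 x hx⟩, h'⟩
    simp only [this, inc, card_filter]
    push_cast
    rw [sum_comm]
  have h2 : ∀ v, ((E.filter (fun e => v ∈ e)).card : ℤ) = dg D v := by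
    intro v
    have : E.filter (fun e => v ∈ e) = (univ.filter (fun w => D.Adj v w)).image (fun w => s(v,w)) := by
      ext e
      induction e with
      | _ a b =>
        simp only [mem_filter, hE, Sym2.mem_iff, mem_image, mem_univ, true_and, Sym2.eq_iff]
        constructor
        · rintro ⟨h, rfl | rfl⟩
          · exact ⟨b, h, by simp⟩
          · exact ⟨a, h.symm, by simp⟩
        · rintro ⟨w, h, ⟨rfl, rfl⟩ | ⟨rfl, rfl⟩⟩
          · exact ⟨h, by simp⟩
          · exact ⟨h.symm, by simp⟩
    rw [this, card_image_of_injective, card_filter, dg]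
    · push_cast; rfl
    · intro a b h
      simp [Sym2.eq_iff] at h
      grind
  rw [h1, mul_sum, sM, s2, ← sum_sub_distrib]
  refine sum_congr rfl fun v _ => ?_
  rw [← h2, card_powersetCard]
  generalize (E.filter (fun e => v ∈ e)).card = d
  have := Nat.choose_two_right d
  have h3 : 2 * d.choose 2 = d * (d - 1) := by
    rw [this, Nat.mul_div_cancel' (Nat.even_mul_pred_self d).two_dvd]
  have h4 : (2 * (d.choose 2 : ℤ)) = d * ((d - 1 : ℕ) : ℤ) := by exact_mod_cast h3
  rw [h4]
  cases d with
  | zero => simp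
  | succ d => simp only [Nat.add_sub_cancel]; push_cast; ring
end
end TL
end
end

section
open Finset
open scoped Classical
noncomputable section
namespace TL

section
variable {V : Type} [DecidableEq V] [Fintype V]

lemma CK_disj (s t : V) : Disjoint (CC s t) (KK s t) := by
  rw [disjoint_left]
  intro e h h'
  simp [CC, KK] at h h'
  tauto

def NN (s t : V) (E : Finset (Sym2 V)) (i : ℕ) : ℕ :=
  ((powersetCard i (CC s t ∪ E)).filter (fun F => rc F s t)).card

def SS (s t : V) (E : Finset (Sym2 V)) (j k : ℕ) : ℤ := ∑ F ∈ powersetCard j E, (rr s t k F : ℤ)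

lemma NN_eq (s t : V) (E : Finset (Sym2 V)) (hE : E ⊆ KK s t) (i : ℕ) :
    (NN s t E i : ℤ) = ∑ j ∈ range (i+1), SS s t E j (i - j) := by
  rw [NN, dec_union _ _ (disjoint_of_subset_right hE (CK_disj s t))]
  push_cast
  rfl

lemma SS0 {s t : V} (hst : s ≠ t) (E : Finset (Sym2 V)) (hE : E ⊆ KK s t) (j : ℕ) : SS s t E j 0 = 0 := by
  rw [SS]
  refine sum_eq_zero fun F hF => ?_
  rw [rr0 hst ((mem_powersetCard.1 hF).1.trans hE)]; rfl

lemma SS1 {s t : V} (hst : s ≠ t) (E : Finset (Sym2 V)) (hE : E ⊆ KK s t) (j : ℕ) :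
    SS s t E j 1 = (E.card.choose j : ℕ) := by
  rw [SS, sum_congr rfl (g := fun _ => (1:ℤ))]
  · simp
  · intro F hF
    rw [rr1 hst ((mem_powersetCard.1 hF).1.trans hE)]; rfl

lemma SS2 {s t : V} (hst : s ≠ t) (E : Finset (Sym2 V)) (hE : E ⊆ KK s t) (j : ℕ) :
    SS s t E j 2 = (E.card.choose j : ℕ) * ((((CC s t).card - 1 : ℕ) : ℤ) - 2) + ∑ F ∈ powersetCard j E, (RP F : ℤ) := by
  rw [SS, sum_congr rfl (g := fun F => ((((CC s t).card - 1 : ℕ) : ℤ) - 2) + (RP F : ℤ)), sum_add_distrib]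
  · simp; ring
  · intro F hF
    have := rr2 hst ((mem_powersetCard.1 hF).1.trans hE)
    omega

lemma SSz (s t : V) (E E' : Finset (Sym2 V)) (k : ℕ) : SS s t E 0 k = SS s t E' 0 k := by simp [SS]

lemma SSone {s t : V} (hst : s ≠ t) (E E' : Finset (Sym2 V)) (hE : E ⊆ KK s t) (hE' : E' ⊆ KK s t)
    (hc : E.card = E'.card) (k : ℕ) : SS s t E 1 k = SS s t E' 1 k := by
  rw [SS, SS]
  have hm : ∀ x ∈ powersetCard 1 E ∪ powersetCard 1 E', x ∈ powersetCard 1 (KK s t) := by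
    intro x hx
    rcases mem_union.1 hx with h | h
    · exact powersetCard_mono hE h
    · exact powersetCard_mono hE' h
  refine sum_two _ _ _ (fun _ => 0) (fun _ _ => Or.inl rfl) ?_ (by simp [hc]) (by simp)
  intro x hx y hy _
  rw [rr_single s t hst k x y (hm x hx) (hm y hy)]

lemma SS_two {s t : V} (hst : s ≠ t) (E E' : Finset (Sym2 V)) (hE : E ⊆ KK s t) (hE' : E' ⊆ KK s t)
    (hc : E.card = E'.card) (k : ℕ) (hi : ∑ F ∈ powersetCard 2 E, inc F = ∑ F ∈ powersetCard 2 E', inc F) :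
    SS s t E 2 k = SS s t E' 2 k := by
  rw [SS, SS]
  have hm : ∀ x ∈ powersetCard 2 E ∪ powersetCard 2 E', x ∈ powersetCard 2 (KK s t) := by
    intro x hx
    rcases mem_union.1 hx with h | h
    · exact powersetCard_mono hE h
    · exact powersetCard_mono hE' h
  refine sum_two _ _ _ inc ?_ ?_ (by simp [hc]) hi
  · intro x hx
    rcases pair_shape s t x (hm x hx) with ⟨a, b, c, _, _, h⟩ | ⟨a, b, c, d, _, _, h⟩
    · exact Or.inr h
    · exact Or.inl h
  · intro x hx y hy h
    rw [rr_pair s t hst k x y (hm x hx) (hm y hy) h]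

variable {s t : V} (hst : s ≠ t) (D D' : SimpleGraph V) (E E' : Finset (Sym2 V)) (hE : E ⊆ KK s t)
    (hE' : E' ⊆ KK s t) (hc : E.card = E'.card) (hD : ∀ u v, s(u,v) ∈ E ↔ D.Adj u v)
    (hD' : ∀ u v, s(u,v) ∈ E' ↔ D'.Adj u v) (hs : s2 D = s2 D')

include hst hE hE' hc in
lemma NN3 : NN s t E 3 = NN s t E' 3 := by
  have h1 := NN_eq s t E hE 3
  have h2 := NN_eq s t E' hE' 3
  simp only [sum_range_succ, range_zero, sum_empty, Nat.reduceSub] at h1 h2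
  have e1 := SSz s t E E' 3
  have e2 := SSone hst E E' hE hE' hc 2
  rw [SS1 hst E hE, SS0 hst E hE] at h1
  rw [SS1 hst E' hE', SS0 hst E' hE', ← hc] at h2
  omega

include hst hE hE' hc hD hD' hs in
lemma NN4 : (NN s t E 4 : ℤ) - NN s t E' 4 = sM D - sM D' := by
  have h1 := NN_eq s t E hE 4
  have h2 := NN_eq s t E' hE' 4
  simp only [sum_range_succ, range_zero, sum_empty, Nat.reduceSub] at h1 h2
  have e1 := SSz s t E E' 4
  have e2 := SSone hst E E' hE hE' hc 3
  rw [SS2 hst E hE, SS1 hst E hE, SS0 hst E hE, rho2 D E hD] at h1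
  rw [SS2 hst E' hE', SS1 hst E' hE', SS0 hst E' hE', rho2 D' E' hD', ← hc, ← hs] at h2
  linarith

include hst hE hE' hc hD hD' hs in
lemma NN5 (hM : sM D = sM D') : (NN s t E 5 : ℤ) - NN s t E' 5 = (sP D - 2 * sT D) - (sP D' - 2 * sT D') := by
  have h1 := NN_eq s t E hE 5
  have h2 := NN_eq s t E' hE' 5
  simp only [sum_range_succ, range_zero, sum_empty, Nat.reduceSub] at h1 h2
  have e1 := SSz s t E E' 5
  have e2 := SSone hst E E' hE hE' hc 4
  have i1 := sum_inc D E hD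
  have i2 := sum_inc D' E' hD'
  have e3 := SS_two hst E E' hE hE' hc 3 (by rw [← hs, ← hM] at i2; linarith)
  rw [SS2 hst E hE, SS1 hst E hE, SS0 hst E hE, rho3 D E hD] at h1
  rw [SS2 hst E' hE', SS1 hst E' hE', SS0 hst E' hE', rho3 D' E' hD', ← hc, ← hs, ← hM] at h2
  linarith

end
end TL
end
end

section
open Finset
open scoped Classical
noncomputable section
namespace TL

section
variable {V : Type} [DecidableEq V] [Fintype V]

def EE (G : SimpleGraph V) : Finset (Sym2 V) := univ.filter (fun e => e ∈ G.edgeSet)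

lemma EE_mem (G : SimpleGraph V) (u v : V) : s(u,v) ∈ EE G ↔ G.Adj u v := by simp [EE]

lemma EE_card (G : SimpleGraph V) : (EE G).card = edgeCount G := by
  rw [edgeCount, ← Set.ncard_coe_finset]
  congr 1
  ext e; simp [EE]

lemma cnt_map (σ : Equiv.Perm V) (E : Finset (Sym2 V)) (a b : V) (i : ℕ) :
    ((powersetCard i (E.image (Sym2.map σ))).filter (fun F => rc F (σ a) (σ b))).card =
    ((powersetCard i E).filter (fun F => rc F a b)).card := by
  symm
  have hinj : Function.Injective (Sym2.map σ) := Sym2.map.injective σ.injective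
  refine card_nbij (fun A => A.image (Sym2.map σ)) ?_ ?_ ?_
  · intro A hA
    simp only [mem_coe, mem_filter, mem_powersetCard] at hA ⊢
    exact ⟨⟨image_subset_image hA.1.1, by rw [card_image_of_injective _ hinj, hA.1.2]⟩, (rc_map σ _ _ _).2 hA.2⟩
  · intro A _ B _ h
    exact image_injective hinj h
  · intro B hB
    simp only [mem_coe, mem_filter, mem_powersetCard] at hB
    obtain ⟨A, hA, rfl⟩ := subset_image_iff.1 hB.1.1
    refine ⟨A, ?_, rfl⟩
    simp only [mem_coe, mem_filter, mem_powersetCard]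
    exact ⟨⟨hA, by rw [← hB.1.2, card_image_of_injective _ hinj]⟩, (rc_map σ _ _ _).1 hB.2⟩

lemma cnt1 (E : Finset (Sym2 V)) (a b : V) (hab : a ≠ b) :
    ((powersetCard 1 E).filter (fun F => rc F a b)).card = if s(a,b) ∈ E then 1 else 0 := by
  have : ∀ F ∈ powersetCard 1 E, rc F a b → F = {s(a,b)} := by
    intro F hF h
    rw [mem_powersetCard] at hF
    obtain ⟨e, rfl⟩ := card_eq_one.1 hF.2
    have h1 : a ∈ e := by
      by_contra hc
      exact no_rc _ a b hab (by simpa) h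
    have h2 : b ∈ e := by
      by_contra hc
      exact no_rc' _ a b hab (by simpa) h
    rw [(Sym2.mem_and_mem_iff hab).1 ⟨h1, h2⟩]
  split_ifs with h
  · rw [card_eq_one]
    refine ⟨{s(a,b)}, ?_⟩
    ext F
    rw [mem_filter, mem_singleton]
    constructor
    · exact fun h => this F h.1 h.2
    · rintro rfl
      exact ⟨by simp [mem_powersetCard, h], rc_adj _ _ _ (by simp)⟩
  · rw [card_eq_zero, filter_eq_empty_iff]
    intro F hF hr
    have := this F hF hr
    subst this
    rw [mem_powersetCard] at hF
    exact h (hF.1 (by simp))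

def dl (G : SimpleGraph V) (s t : V) : SimpleGraph {v // v ≠ s ∧ v ≠ t} := SimpleGraph.comap Subtype.val G

def dc (G : SimpleGraph V) (s t : V) : SimpleGraph V where
  Adj u v := G.Adj u v ∧ (u ≠ s ∧ u ≠ t) ∧ (v ≠ s ∧ v ≠ t)
  symm := ⟨fun u v h => ⟨h.1.symm, h.2.2, h.2.1⟩⟩
  loopless := ⟨fun u h => h.1.ne rfl⟩

lemma sum_W (s t : V) [Fintype {v // v ≠ s ∧ v ≠ t}] (f : V → ℤ) (hs : f s = 0) (ht : f t = 0) :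
    ∑ v, f v = ∑ w : {v // v ≠ s ∧ v ≠ t}, f w := by
  rw [← Finset.sum_subtype (univ.filter (fun v => v ≠ s ∧ v ≠ t)) (by simp) f]
  symm
  apply Finset.sum_filter_of_ne
  intro x _ hx
  constructor
  · rintro rfl; exact hx hs
  · rintro rfl; exact hx ht

section
variable (G : SimpleGraph V) (s t : V)

lemma AAs (v : V) : AA (dc G s t) s v = 0 := by simp [AA, dc]
lemma AAt (v : V) : AA (dc G s t) t v = 0 := by simp [AA, dc]
lemma AAs' (v : V) : AA (dc G s t) v s = 0 := by simp [AA, dc]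
lemma AAt' (v : V) : AA (dc G s t) v t = 0 := by simp [AA, dc]
lemma AAw (u v : {v // v ≠ s ∧ v ≠ t}) : AA (dc G s t) u v = AA (dl G s t) u v := by
  simp [AA, dc, dl, u.2, v.2]

variable [Fintype {v // v ≠ s ∧ v ≠ t}]
lemma dgs : dg (dc G s t) s = 0 := by simp [dg, AAs]
lemma dgt : dg (dc G s t) t = 0 := by simp [dg, AAt]
lemma dgw (u : {v // v ≠ s ∧ v ≠ t}) : dg (dc G s t) u = dg (dl G s t) u := by
  rw [dg, sum_W s t _ (AAs' _ _ _ _) (AAt' _ _ _ _)]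
  simp only [AAw]; rfl

lemma s2_dc : s2 (dc G s t) = s2 (dl G s t) := by
  rw [s2, sum_W s t _ (dgs _ _ _) (dgt _ _ _)]; simp only [dgw]; rfl
lemma sM_dc : sM (dc G s t) = sM (dl G s t) := by
  rw [sM, sum_W s t _ (by simp [dgs]) (by simp [dgt])]; simp only [dgw]; rfl
lemma sP_dc : sP (dc G s t) = sP (dl G s t) := by
  rw [sP, sum_W s t _ (by simp [dgs]) (by simp [dgt])]
  refine sum_congr rfl fun u _ => ?_
  rw [sum_W s t _ (by simp [dgs]) (by simp [dgt])]; simp only [dgw, AAw]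
lemma sT_dc : sT (dc G s t) = sT (dl G s t) := by
  rw [sT, sum_W s t _ (by simp [AAs]) (by simp [AAt])]
  refine sum_congr rfl fun u _ => ?_
  rw [sum_W s t _ (by simp [AAs]) (by simp [AAt])]
  refine sum_congr rfl fun v _ => ?_
  rw [sum_W s t _ (by simp [AAs']) (by simp [AAt'])]
  simp only [AAw]
end

lemma KK_dc (G : SimpleGraph V) (s t u v : V) : s(u,v) ∈ EE G ∩ KK s t ↔ (dc G s t).Adj u v := by
  simp only [mem_inter, EE_mem, KK, mem_filter, mem_univ, true_and, Sym2.mk_isDiag_iff, Sym2.mem_iff, dc, not_or]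
  constructor
  · rintro ⟨h1, h2, h3, h4⟩
    exact ⟨h1, ⟨Ne.symm h3.1, Ne.symm h4.1⟩, Ne.symm h3.2, Ne.symm h4.2⟩
  · rintro ⟨h1, h2, h3⟩
    exact ⟨h1, h1.ne, ⟨h2.1.symm, h3.1.symm⟩, h2.2.symm, h3.2.symm⟩

lemma EE_univ (G : SimpleGraph V) (s t : V) (hs : ∀ v, v ≠ s → G.Adj s v) (ht : ∀ v, v ≠ t → G.Adj t v) :
    EE G = CC s t ∪ (EE G ∩ KK s t) := by
  ext e
  induction e with
  | _ a b =>
    simp only [mem_union, mem_inter, EE_mem, CC, KK, mem_filter, mem_univ, true_and, Sym2.mk_isDiag_iff]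
    constructor
    · intro h
      have := h.ne
      tauto
    · rintro (⟨h, h1⟩ | h)
      · simp only [Sym2.mem_iff] at h1
        rcases h1 with (rfl | rfl) | (rfl | rfl)
        · exact hs _ (Ne.symm h)
        · exact (hs _ h).symm
        · exact ht _ (Ne.symm h)
        · exact (ht _ h).symm
      · exact h.1
end

lemma ncoeff_eq {n : ℕ} (G : TwoTerminalGraph n) (i : ℕ) :
    Ncoeff G i = ((powersetCard i (EE G.graph)).filter (fun F => rc F G.s G.t)).card := by
  rw [Ncoeff, ← Set.ncard_coe_finset, ← Set.ncard_image_of_injective _ Finset.coe_injective]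
  congr 1
  ext F
  simp only [Set.mem_ofPred_eq, Set.mem_image, mem_coe, mem_filter, mem_powersetCard]
  constructor
  · rintro ⟨h1, h2, h3⟩
    refine ⟨F.toFinset, ⟨⟨?_, ?_⟩, ?_⟩, by simp⟩
    · intro e he; simp [EE]; exact h1 (by simpa using he)
    · rw [← h2, Set.ncard_eq_toFinset_card']
    · rw [rc]; simpa using h3
  · rintro ⟨A, ⟨⟨h1, h2⟩, h3⟩, rfl⟩
    refine ⟨?_, by rw [Set.ncard_coe_finset, h2], h3⟩
    intro e he
    have := h1 (mem_coe.1 he)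
    simpa [EE] using this

lemma ncoeff_iso {n : ℕ} (G H : TwoTerminalGraph n) (e : G.graph ≃g H.graph) (hs : e G.s = H.s)
    (ht : e G.t = H.t) (i : ℕ) : Ncoeff G i = Ncoeff H i := by
  rw [ncoeff_eq, ncoeff_eq, ← cnt_map e.toEquiv]
  have h1 : (EE G.graph).image (Sym2.map e.toEquiv) = EE H.graph := by
    ext x
    induction x with
    | _ a b =>
      rw [EE_mem, mem_image]
      constructor
      · rintro ⟨y, hy, h⟩
        induction y with
        | _ c d =>
          rw [EE_mem] at hy
          rw [Sym2.map_mk, ← SimpleGraph.mem_edgeSet, ← h] at *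
          exact e.map_adj_iff.2 hy
      · intro h
        refine ⟨s(e.symm a, e.symm b), ?_, ?_⟩
        · rw [EE_mem]; exact e.symm.map_adj_iff.2 h
        · rw [Sym2.map_mk]
          exact congrArg₂ (fun x y => s(x,y)) (e.apply_symm_apply a) (e.apply_symm_apply b)
  rw [h1]
  have h2 : e.toEquiv G.s = H.s := hs
  have h3 : e.toEquiv G.t = H.t := ht
  rw [h2, h3]

end TL
end
end

section
open Finset
open scoped Classical
noncomputable section
namespace TL

lemma core {n m M : ℕ} (hm : 6 ≤ m) (hn : 4 ≤ n) (s t : Fin n) (hst : s ≠ t)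
    [Fintype {v : Fin n // v ≠ s ∧ v ≠ t}] (g h : SimpleGraph (Fin n))
    (hg : edgeCount g = m) (hh : edgeCount h = m)
    (hs : ∀ v, v ≠ s → g.Adj s v) (ht : ∀ v, v ≠ t → g.Adj t v)
    (hH : HOptimal M (dl g s t)) :
    (∃ δ > 0, ∀ p ∈ Set.Ioo (0:ℝ) δ, relia m ⟨h, s, t, hst⟩ p < relia m ⟨g, s, t, hst⟩ p) ∨
    (∃ e : h ≃g g, e s = s ∧ e t = t) := by
  have nz : ∀ x : TwoTerminalGraph n, ∀ j, j < 1 → 1 ≤ j → Ncoeff x j = 0 := by intros; omega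
  have n1 : ∀ x : SimpleGraph (Fin n), Ncoeff ⟨x, s, t, hst⟩ 1 = if x.Adj s t then 1 else 0 := by
    intro x
    rw [ncoeff_eq, cnt1 _ _ _ hst]
    simp only [EE_mem]
  have g1 : g.Adj s t := hs t hst.symm
  by_cases h1 : h.Adj s t
  swap
  · left
    refine relia_lt m 1 _ _ le_rfl (by omega) (by intros; omega) ?_
    rw [n1, n1, if_pos g1, if_neg h1]; exact one_pos
  have e1 : Ncoeff ⟨h, s, t, hst⟩ 1 = Ncoeff ⟨g, s, t, hst⟩ 1 := by rw [n1, n1, if_pos g1, if_pos h1]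
  have n2 : ∀ x : SimpleGraph (Fin n), x.Adj s t → edgeCount x = m →
      (Ncoeff ⟨x, s, t, hst⟩ 2 : ℤ) = (m - 1) + (cod x s t).card := by
    intro x hx hxm
    rw [ncoeff_eq, cnt2 x (EE x) (EE_mem x) _ _ hst, ← cod_AA, EE_card, hxm, AA, if_pos hx, one_mul]
  have csub : cod h s t ⊆ cod g s t := by
    intro c hc
    simp only [cod, mem_filter, mem_univ, true_and] at hc ⊢
    exact ⟨hs c hc.1.ne', (ht c hc.2.ne).symm⟩
  by_cases hcod : cod h s t = cod g s t
  swap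
  · left
    refine relia_lt m 2 _ _ (by norm_num) (by omega) ?_ ?_
    · intro j hj hj1
      obtain rfl : j = 1 := by omega
      exact e1
    · have := card_lt_card (ssubset_of_subset_of_ne csub hcod)
      have a := n2 h h1 hh
      have b := n2 g g1 hg
      omega
  have e2 : Ncoeff ⟨h, s, t, hst⟩ 2 = Ncoeff ⟨g, s, t, hst⟩ 2 := by
    have a := n2 h h1 hh
    have b := n2 g g1 hg
    rw [hcod] at a
    omega
  have hc : ∀ c, c ≠ s → c ≠ t → h.Adj s c ∧ h.Adj c t := by
    intro c h2 h3
    have : c ∈ cod g s t := by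
      simp only [cod, mem_filter, mem_univ, true_and]
      exact ⟨hs c h2, (ht c h3).symm⟩
    rw [← hcod] at this
    simpa only [cod, mem_filter, mem_univ, true_and] using this
  have hs' : ∀ v, v ≠ s → h.Adj s v := by
    intro v hv
    by_cases hvt : v = t
    · rw [hvt]; exact h1
    · exact (hc v hv hvt).1
  have ht' : ∀ v, v ≠ t → h.Adj t v := by
    intro v hv
    by_cases hvt : v = s
    · rw [hvt]; exact h1.symm
    · exact (hc v hvt hv).2.symm
  have eN : ∀ x : SimpleGraph (Fin n), (∀ v, v ≠ s → x.Adj s v) → (∀ v, v ≠ t → x.Adj t v) → ∀ i,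
      Ncoeff ⟨x, s, t, hst⟩ i = NN s t (EE x ∩ KK s t) i := by
    intro x ha hb i
    rw [ncoeff_eq, NN, ← EE_univ x s t ha hb]
  have ec : ∀ x : SimpleGraph (Fin n), (∀ v, v ≠ s → x.Adj s v) → (∀ v, v ≠ t → x.Adj t v) → 
      edgeCount x = (CC s t).card + (EE x ∩ KK s t).card := by
    intro x ha hb
    rw [← EE_card, ← card_union_of_disjoint, ← EE_univ x s t ha hb]
    exact (CK_disj s t).mono_right inter_subset_right
  have hcard : (EE h ∩ KK s t).card = (EE g ∩ KK s t).card := by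
    have := ec h hs' ht'
    have := ec g hs ht
    omega
  have EEdc : ∀ x : SimpleGraph (Fin n), EE x ∩ KK s t = EE (dc x s t) := by
    intro x
    ext e
    induction e with
    | _ a b => rw [KK_dc, EE_mem]
  have hs2 : s2 (dc h s t) = s2 (dc g s t) := by
    rw [s2_e, s2_e, ← EE_card, ← EE_card, ← EEdc, ← EEdc, hcard]
  have hec : edgeCount (dl h s t) = edgeCount (dl g s t) := by
    rw [s2_dc, s2_dc, s2_e, s2_e] at hs2
    omega
  have e3 : Ncoeff ⟨h, s, t, hst⟩ 3 = Ncoeff ⟨g, s, t, hst⟩ 3 := by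
    rw [eN h hs' ht', eN g hs ht]
    exact NN3 hst _ _ inter_subset_right inter_subset_right hcard
  have d4 := NN4 hst (dc h s t) (dc g s t) _ _ inter_subset_right inter_subset_right hcard (KK_dc h s t) (KK_dc g s t) hs2
  have d5 := NN5 hst (dc h s t) (dc g s t) _ _ inter_subset_right inter_subset_right hcard (KK_dc h s t) (KK_dc g s t) hs2
  rw [← eN h hs' ht', ← eN g hs ht, sM_dc, sM_dc, sM_e, sM_e] at d4
  rw [← eN h hs' ht', ← eN g hs ht, sM_dc, sM_dc, sP_dc, sP_dc, sT_dc, sT_dc, ← two_H, ← two_H, sM_e, sM_e] at d5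
  have hMle := hH.1.2 (dl h s t) (hec.trans hH.1.1)
  rcases hMle.lt_or_eq with hlt | heq
  · left
    refine relia_lt m 4 _ _ (by norm_num) (by omega) ?_ (by omega)
    intro j hj hj1
    interval_cases j
    · exact e1
    · exact e2
    · exact e3
  have e4 : Ncoeff ⟨h, s, t, hst⟩ 4 = Ncoeff ⟨g, s, t, hst⟩ 4 := by omega
  have d5 := d5 (by rw [heq])
  have hMo : MOptimal M (dl h s t) := ⟨hec.trans hH.1.1, fun x hx => heq ▸ hH.1.2 x hx⟩
  have hHle := hH.2 _ hMo
  rcases hHle.lt_or_eq with hlt | heq'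
  · left
    refine relia_lt m 5 _ _ (by norm_num) (by omega) ?_ (by omega)
    intro j hj hj1
    interval_cases j
    · exact e1
    · exact e2
    · exact e3
    · exact e4
  right
  have hHo : HOptimal M (dl h s t) := ⟨hMo, fun x hx => heq' ▸ hH.2 x hx⟩
  haveI : Nonempty {v : Fin n // v ≠ s ∧ v ≠ t} := by
    have : ({s, t} : Finset (Fin n)).card < (univ : Finset (Fin n)).card := by
      have := card_le_two (a := s) (b := t)
      rw [card_univ, Fintype.card_fin]
      omega
    obtain ⟨v, _, hv⟩ := exists_mem_notMem_of_card_lt_card this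
    simp only [mem_insert, mem_singleton, not_or] at hv
    exact ⟨⟨v, hv⟩⟩
  obtain ⟨e⟩ := hopt_unique M _ _ hHo hH rfl
  have f1 : ∀ x (hx : x ≠ s ∧ x ≠ t), Equiv.Perm.ofSubtype e.toEquiv x = e ⟨x, hx⟩ :=
    fun x hx => Equiv.Perm.ofSubtype_apply_coe e.toEquiv ⟨x, hx⟩
  have f2 : Equiv.Perm.ofSubtype e.toEquiv s = s := Equiv.Perm.ofSubtype_apply_of_not_mem _ (by simp)
  have f3 : Equiv.Perm.ofSubtype e.toEquiv t = t := Equiv.Perm.ofSubtype_apply_of_not_mem _ (by simp)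
  set τ := Equiv.Perm.ofSubtype e.toEquiv with hτ
  have fs : ∀ x, x ≠ s → τ x ≠ s := fun x hx h => hx (τ.injective (h.trans f2.symm))
  have ft : ∀ x, x ≠ t → τ x ≠ t := fun x hx h => hx (τ.injective (h.trans f3.symm))
  refine ⟨⟨τ, ?_⟩, f2, f3⟩
  intro a b
  by_cases hab : a = b
  · subst hab; simp
  have hab' : τ a ≠ τ b := fun h => hab (τ.injective h)
  by_cases has : a = s
  · subst has
    rw [f2] at hab' ⊢
    exact ⟨fun _ => hs' _ (Ne.symm hab), fun _ => hs _ hab'.symm⟩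
  by_cases hat : a = t
  · subst hat
    rw [f3] at hab' ⊢
    exact ⟨fun _ => ht' _ (Ne.symm hab), fun _ => ht _ hab'.symm⟩
  by_cases hbs : b = s
  · subst hbs
    rw [f2] at hab' ⊢
    exact ⟨fun _ => (hs' _ hab).symm, fun _ => (hs _ hab').symm⟩
  by_cases hbt : b = t
  · subst hbt
    rw [f3] at hab' ⊢
    exact ⟨fun _ => (ht' _ hab).symm, fun _ => (ht _ hab').symm⟩
  rw [f1 a ⟨has, hat⟩, f1 b ⟨hbs, hbt⟩]
  exact e.map_adj_iff (v := ⟨a, has, hat⟩) (w := ⟨b, hbs, hbt⟩)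

lemma relia_iso {n : ℕ} (m : ℕ) (G H : TwoTerminalGraph n) (e : G.graph ≃g H.graph) (hs : e G.s = H.s)
    (ht : e G.t = H.t) (p : ℝ) : relia m G p = relia m H p := by
  simp only [relia, ncoeff_iso G H e hs ht]

lemma claim {n m M : ℕ} (hm : 6 ≤ m) (hn : 4 ≤ n) (G : TwoTerminalGraph n)
    [Fintype {v : Fin n // v ≠ G.s ∧ v ≠ G.t}] (hG : G ∈ TT n m)
    (hs : ∀ v, v ≠ G.s → G.graph.Adj G.s v) (ht : ∀ v, v ≠ G.t → G.graph.Adj G.t v)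
    (hH : HOptimal M (deleteTerminals G)) (H : TwoTerminalGraph n) (hHm : H ∈ TT n m) :
    (∃ δ > 0, ∀ p ∈ Set.Ioo (0:ℝ) δ, relia m H p < relia m G p) ∨
    (TTIso H G ∧ ∀ p, relia m H p = relia m G p) := by
  obtain ⟨σ, hσ⟩ := perm_list [H.s, H.t] [G.s, G.t] (by simp [H.hst]) (by simp [G.hst]) rfl
  simp only [List.map_cons, List.map_nil, List.cons.injEq, and_true] at hσ
  let f := SimpleGraph.Iso.map σ H.graph
  have hfm : edgeCount (SimpleGraph.map σ H.graph) = m := by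
    have h1 : edgeCount H.graph = m := hHm
    rw [← h1, edgeCount, edgeCount, ← Nat.card_coe_set_eq, ← Nat.card_coe_set_eq]
    exact Nat.card_congr f.mapEdgeSet.symm
  have hrel : ∀ p, relia m H p = relia m ⟨SimpleGraph.map σ H.graph, G.s, G.t, G.hst⟩ p :=
    relia_iso m H ⟨SimpleGraph.map σ H.graph, G.s, G.t, G.hst⟩ f hσ.1 hσ.2
  rcases core hm hn G.s G.t G.hst G.graph (SimpleGraph.map σ H.graph) hG hfm hs ht hH with h | ⟨e, h1, h2⟩
  · left
    obtain ⟨δ, h0, h⟩ := h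
    refine ⟨δ, h0, fun p hp => ?_⟩
    rw [hrel]
    exact h p hp
  · right
    have a1 : (f.trans e) H.s = G.s := (congrArg e hσ.1).trans h1
    have a2 : (f.trans e) H.t = G.t := (congrArg e hσ.2).trans h2
    exact ⟨⟨f.trans e, Or.inl ⟨a1, a2⟩⟩, relia_iso m H G (f.trans e) a1 a2⟩

end TL
end
end

theorem stmt2 (n m : ℕ) (hn : 4 ≤ n) (hm1 : 2*n - 3 < m) (hm2 : m ≤ n.choose 2)
    (G : TwoTerminalGraph n) (hG : G ∈ TT n m)
    (hs : ∀ v : Fin n, v ≠ G.s → G.graph.Adj G.s v)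
    (ht : ∀ v : Fin n, v ≠ G.t → G.graph.Adj G.t v)
    (hH : HOptimal (m - (2*n - 3)) (deleteTerminals G)) :
    IsLMRTTG n m G ∧ ∀ H : TwoTerminalGraph n, IsLMRTTG n m H → TTIso H G := by
  have key := TL.claim (by omega) hn G hG hs ht hH
  refine ⟨⟨hG, fun H hHm => ?_⟩, fun H hL => ?_⟩
  · rcases key H hHm with ⟨δ, h0, h⟩ | ⟨_, h⟩
    · exact ⟨δ, h0, fun p hp => (h p hp).le⟩
    · exact ⟨1, one_pos, fun p _ => (h p).le⟩
  · rcases key H hL.1 with ⟨δ, h0, h⟩ | ⟨h, _⟩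
    · exfalso
      obtain ⟨δ', h0', h'⟩ := hL.2 G hG
      have hp : 0 < min δ δ' := lt_min h0 h0'
      have l1 := min_le_left δ δ'
      have l2 := min_le_right δ δ'
      have a := h (min δ δ' / 2) ⟨by linarith, by linarith⟩
      have b := h' (min δ δ' / 2) ⟨by linarith, by linarith⟩
      linarith
    · exact h
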